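/- (1) Let w and z be irreducible elements of S, with w of type (B) and z of type (C). Then the following are equivalent: (a) Ext¹_S(S/zS, S/wS) = 0 (right modules); (b) Ext¹_S(S/Sw, S/Sz) = 0 (left modules); (c) Ext¹_T(T/zT, T/wT) = 0; (d) Ext¹_T(T/Tw, T/Tz) = 0. (2) S satisfies right (◊) if and only if these equivalent statements hold for all such pairs of elements z and w. -/

import Mathlib

open MulOpposite

universe u

/-- `φ : R →+* S` and `θ : S` exhibit `S` as the skew polynomial ring `R[θ; α]`:
`θ · r = α(r) · θ`, and every element of `S` is uniquely a polynomial `Σ rᵢ θ^i`. -/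
structure IsSkewPolynomialRing {R S : Type u} [CommRing R] [Ring S]
    (α : R ≃+* R) (φ : R →+* S) (θ : S) : Prop where
  commutes : ∀ r : R, θ * φ r = φ (α r) * θ
  bijective : Function.Bijective fun p : ℕ →₀ R => p.sum fun n r => φ r * θ ^ n

/-- `ψ : S →+* T` exhibits `T` as the (Ore) localization of `S` inverting the
powers of the normal element `x`. -/
structure IsLocalizationAt {S T : Type u} [Ring S] [Ring T] (x : S) (ψ : S →+* T) : Prop where
  inj : Function.Injective ψ
  unit : IsUnit (ψ x)
  surj : ∀ t : T, ∃ (s : S) (n : ℕ), t * ψ x ^ n = ψ s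

/-- The right ideal `zS`. -/
abbrev rSpan (S : Type u) [Ring S] (z : S) : Submodule Sᵐᵒᵖ S := Submodule.span Sᵐᵒᵖ {z}

/-- The left ideal `Sz`. -/
abbrev lSpan (S : Type u) [Ring S] (z : S) : Submodule S S := Submodule.span S {z}

/-- The cyclic right `S`-module `S/zS`. -/
abbrev rQuot (S : Type u) [Ring S] (z : S) : Type u := S ⧸ rSpan S z

/-- The cyclic left `S`-module `S/Sz`. -/
abbrev lQuot (S : Type u) [Ring S] (z : S) : Type u := S ⧸ lSpan S z

/-- The cyclic right `S`-module `S/(aS + bS)`. -/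
abbrev rQuot2 (S : Type u) [Ring S] (a b : S) : Type u := S ⧸ (rSpan S a ⊔ rSpan S b)

/-- Two elements of `T` are similar if `T/aT ≅ T/bT` as right `T`-modules. -/
def SimilarIn (T : Type u) [Ring T] (a b : T) : Prop :=
  Nonempty (rQuot T a ≃ₗ[Tᵐᵒᵖ] rQuot T b)

/-- The image in `S` of a polynomial `p ∈ k[θ]`, i.e. `Σ φ(pᵢ) θ^i`. -/
def thetaPoly {k R S : Type u} [CommSemiring k] [CommRing R] [Ring S] [Algebra k R]
    (φ : R →+* S) (θ : S) (p : Polynomial k) : S :=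
  p.sum fun n c => φ (algebraMap k R c) * θ ^ n

/-- Type (A) irreducibles of `S = R[θ; α]`: unit multiples of `X` or `θ`. -/
def IsTypeA {R S : Type u} [CommRing R] [Ring S] (X : R) (φ : R →+* S) (θ : S) (z : S) : Prop :=
  ∃ u : Sˣ, (u : S) * z = φ X ∨ (u : S) * z = θ

/-- Type (B) irreducibles of `S = R[θ; α]`: unit multiples of `1 + Xs`, `s ∈ S∖R`. -/
def IsTypeB {R S : Type u} [CommRing R] [Ring S] (X : R) (φ : R →+* S) (z : S) : Prop :=
  ∃ (u : Sˣ) (s : S), s ∉ Set.range φ ∧ (u : S) * z = 1 + φ X * s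

/-- Type (C) irreducibles of `S = R[θ; α]`: unit multiples of `f + Xs` with
`f ∈ k[θ]∖k` monic and the element not equal to `θ`. -/
def IsTypeC (k : Type u) {R S : Type u} [CommSemiring k] [CommRing R] [Ring S] [Algebra k R]
    (X : R) (φ : R →+* S) (θ : S) (z : S) : Prop :=
  ∃ (u : Sˣ) (p : Polynomial k) (s : S), p.Monic ∧ 1 ≤ p.natDegree ∧
    (u : S) * z = thetaPoly φ θ p + φ X * s ∧ (u : S) * z ≠ θ

/-- A module is locally Artinian if all its finitely generated submodules are Artinian. -/
def IsLocallyArtinian (A M : Type u) [Ring A] [AddCommGroup M] [Module A M] : Prop :=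
  ∀ N : Submodule A M, N.FG → IsArtinian A N

/-- A submodule is essential if it meets every nonzero submodule nontrivially. -/
def IsEssentialSubmodule {A : Type u} [Ring A] {E : Type u} [AddCommGroup E] [Module A E]
    (U : Submodule A E) : Prop :=
  ∀ W : Submodule A E, W ≠ ⊥ → W ⊓ U ≠ ⊥

/-- `f : V →ₗ[A] E` exhibits `E` as an injective hull of `V`. -/
def IsInjectiveHullVia (A : Type u) [Ring A] {V E : Type u} [AddCommGroup V] [Module A V]
    [AddCommGroup E] [Module A E] (f : V →ₗ[A] E) : Prop :=
  Module.Injective A E ∧ Function.Injective f ∧ IsEssentialSubmodule (LinearMap.range f)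

/-- Property (◊) for left `A`-modules: the injective hull of every simple left `A`-module
is locally Artinian.  (Apply with `A = Sᵐᵒᵖ` for the right-module version.) -/
def HasDiamond (A : Type u) [Ring A] : Prop :=
  ∀ (V E : Type u) [AddCommGroup V] [Module A V] [AddCommGroup E] [Module A E]
    (f : V →ₗ[A] E), IsSimpleModule A V → IsInjectiveHullVia A f → IsLocallyArtinian A E

/-- Gabriel–Rentschler Krull dimension at most `n`; the base case `n = 0` is
`Artinian`, and `Kdim M ≤ n + 1` iff in every descending chain of submodules almost
all successive factors have Krull dimension at most `n`. -/
def KdimLE (A : Type u) [Ring A] : ℕ → ∀ (M : Type u) [AddCommGroup M] [Module A M], Prop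
  | 0, M, _, _ => IsArtinian A M
  | n + 1, M, _, _ =>
      ∀ f : ℕ → Submodule A M, (∀ i, f (i + 1) ≤ f i) →
        ∃ N : ℕ, ∀ i, N ≤ i →
          KdimLE A n (↥(f i) ⧸ Submodule.comap (f i).subtype (f (i + 1)))

/-- A `1`-critical module: Krull dimension exactly `1`, and all proper factors of
Krull dimension `< 1`, i.e. Artinian. -/
def IsOneCritical (A : Type u) [Ring A] (M : Type u) [AddCommGroup M] [Module A M] : Prop :=
  KdimLE A 1 M ∧ ¬ IsArtinian A M ∧ ∀ N : Submodule A M, N ≠ ⊥ → IsArtinian A (M ⧸ N)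

/-- A right `S`-module is `𝒳`-torsion free (`𝒳 = {xⁿ}`). -/
def IsXTorsionFree {S : Type u} [Ring S] (x : S) (M : Type u) [AddCommGroup M]
    [Module Sᵐᵒᵖ M] : Prop :=
  ∀ (m : M) (n : ℕ), op (x ^ n) • m = 0 → m = 0

/-- A right `S`-module is `𝒳`-torsion (`𝒳 = {xⁿ}`). -/
def IsXTorsion {S : Type u} [Ring S] (x : S) (M : Type u) [AddCommGroup M]
    [Module Sᵐᵒᵖ M] : Prop :=
  ∀ m : M, ∃ n : ℕ, op (x ^ n) • m = 0

/-- The central embedding of `k` into `Sᵐᵒᵖ` coming from `k → R → S`. -/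
def opScalars {k R S : Type u} [CommSemiring k] [CommRing R] [Ring S] [Algebra k R]
    (φ : R →+* S) : k →+* Sᵐᵒᵖ where
  toFun c := op (φ (algebraMap k R c))
  map_one' := by simp
  map_mul' x y := by
    show op (φ (algebraMap k R (x * y))) = op (φ (algebraMap k R x)) * op (φ (algebraMap k R y))
    rw [mul_comm x y, map_mul, map_mul, op_mul]
  map_zero' := by simp
  map_add' x y := by
    show op (φ (algebraMap k R (x + y))) = op (φ (algebraMap k R x)) + op (φ (algebraMap k R y))
    rw [map_add, map_add, op_add]

/-- A right `S`-module is finite dimensional over the central subfield `k`. -/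
def FinDimOver (k : Type u) {R S : Type u} [Field k] [CommRing R] [Ring S] [Algebra k R]
    (φ : R →+* S) (M : Type u) [AddCommGroup M] [Module Sᵐᵒᵖ M] : Prop :=
  letI : Module k M := Module.compHom M (opScalars φ)
  Module.Finite k M

/-- A left `S`-module is finite dimensional over the central subfield `k`. -/
def FinDimOverLeft (k : Type u) {R S : Type u} [Field k] [CommRing R] [Ring S] [Algebra k R]
    (φ : R →+* S) (M : Type u) [AddCommGroup M] [Module S M] : Prop :=
  letI : Module k M := Module.compHom M (φ.comp (algebraMap k R))
  Module.Finite k M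

/-- `Ext¹_A(U, V) = 0`: every short exact sequence `0 → V → Y → U → 0` splits. -/
def ExtVanish (A : Type u) [Ring A] (U V : Type u) [AddCommGroup U] [Module A U]
    [AddCommGroup V] [Module A V] : Prop :=
  ∀ (Y : Type u) [AddCommGroup Y] [Module A Y] (i : V →ₗ[A] Y) (p : Y →ₗ[A] U),
    Function.Injective i → Function.Surjective p → LinearMap.range i = LinearMap.ker p →
    ∃ r : Y →ₗ[A] V, r.comp i = LinearMap.id

/-- The right `S`-module `V` is isomorphic, as an `S`-module, to the right `T`-module `Q`
(`T` an `S`-ring via `ψ`). -/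
def SModIsoOfT {S T : Type u} [Ring S] [Ring T] (ψ : S →+* T)
    (V : Type u) [AddCommGroup V] [Module Sᵐᵒᵖ V]
    (Q : Type u) [AddCommGroup Q] [Module Tᵐᵒᵖ Q] : Prop :=
  ∃ e : V ≃+ Q, ∀ (s : S) (v : V), e (op s • v) = op (ψ s) • e v

/-- Two modules are hull-similar: they contain nonzero isomorphic submodules
(equivalently, their injective hulls are isomorphic). -/
def HullSimilar (A : Type u) [Ring A] (M N : Type u) [AddCommGroup M] [Module A M]
    [AddCommGroup N] [Module A N] : Prop :=
  ∃ (P : Submodule A M) (Q : Submodule A N), P ≠ ⊥ ∧ Q ≠ ⊥ ∧ Nonempty (P ≃ₗ[A] Q)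

/-- Restriction of scalars along `ψ : S →+* T` for right modules. -/
def restrictOp {S T : Type u} [Ring S] [Ring T] (ψ : S →+* T)
    (E : Type u) [AddCommGroup E] [Module Tᵐᵒᵖ E] : Module Sᵐᵒᵖ E :=
  Module.compHom E (RingHom.op ψ)

/-- `f : V →+ E` exhibits `E` as an injective hull of the `A`-module `V`,
where `f` is additionally required to be `A`-linear. -/
def IsInjectiveHullViaAdd (A : Type u) [Ring A] {V E : Type u} [AddCommGroup V] [Module A V]
    [AddCommGroup E] [Module A E] (f : V →+ E) : Prop :=
  Module.Injective A E ∧ Function.Injective f ∧ (∀ (a : A) (v : V), f (a • v) = a • f v) ∧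
    ∀ W : Submodule A E, W ≠ ⊥ → ∃ x : E, x ≠ 0 ∧ x ∈ W ∧ x ∈ Set.range f


/-- The facts about `S = R[θ; α]` used in the module theoretic arguments. -/
structure SkewFacts {k S : Type u} [Field k] [Ring S] (x : S) (π : S →+* Polynomial k)
    (c : k →+* S) (θ : S) (ℓ deg : S → ℕ) : Prop where
  nontriv : Nontrivial S
  nzd : NoZeroDivisors S
  ker : ∀ s : S, π s = 0 ↔ ∃ t, s = x * t
  xne : x ≠ 0
  normal1 : ∀ s : S, ∃ t, s * x = x * t
  normal2 : ∀ s : S, ∃ t, x * s = t * x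
  central : ∀ (a : k) (s : S), c a * s = s * c a
  pic : ∀ a, π (c a) = Polynomial.C a
  piθ : π θ = Polynomial.X
  ℓmul : ∀ a b : S, a ≠ 0 → b ≠ 0 → ℓ (a * b) = ℓ a + ℓ b
  ℓunit : ∀ a : S, a ≠ 0 → (ℓ a = 0 ↔ IsUnit a)
  degx : ∀ s : S, deg (s * x) = deg s
  division : ∀ g a : S, g ≠ 0 → ∃ (N : ℕ) (b r : S), a * x ^ N = g * b + r ∧ (r = 0 ∨ deg r < deg g)

namespace SkewAux

open Polynomial

variable {R S : Type u} [CommRing R] [Ring S] {α : R ≃+* R} {φ : R →+* S} {θ : S}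

/-- evaluation of a polynomial in the skew ring. -/
noncomputable def ev (φ : R →+* S) (θ : S) : Polynomial R →+ S where
  toFun p := p.sum fun n r => φ r * θ ^ n
  map_zero' := by simp
  map_add' p q := by
    apply Polynomial.sum_add_index
    · intro i; simp
    · intro i a b; simp [add_mul]

theorem ev_monomial (n : ℕ) (r : R) : ev φ θ (monomial n r) = φ r * θ ^ n := by
  simp [ev, Polynomial.sum_monomial_index]

theorem ev_bij (h : IsSkewPolynomialRing α φ θ) : Function.Bijective (ev φ θ) := by
  classical
  constructor
  · intro p q hpq
    let F : Polynomial R → (ℕ →₀ R) := fun p => ⟨p.support, p.coeff, fun n => by simp⟩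
    have : F p = F q := h.bijective.1 hpq
    ext n
    exact DFunLike.congr_fun this n
  · intro s
    obtain ⟨q, hq⟩ := h.bijective.2 s
    refine ⟨∑ n ∈ q.support, monomial n (q n), ?_⟩
    rw [map_sum, ← hq]
    simp only [ev_monomial]
    rfl

/-- the additive equivalence between the skew ring and polynomials. -/
noncomputable def Q (h : IsSkewPolynomialRing α φ θ) : S ≃+ Polynomial R :=
  (AddEquiv.ofBijective (ev φ θ) (ev_bij h)).symm

theorem Q_ev (h : IsSkewPolynomialRing α φ θ) (p : Polynomial R) : Q h (ev φ θ p) = p :=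
  (AddEquiv.ofBijective (ev φ θ) (ev_bij h)).symm_apply_apply p

theorem ev_Q (h : IsSkewPolynomialRing α φ θ) (s : S) : ev φ θ (Q h s) = s :=
  (AddEquiv.ofBijective (ev φ θ) (ev_bij h)).apply_symm_apply s

theorem Q_mon (h : IsSkewPolynomialRing α φ θ) (n : ℕ) (r : R) :
    Q h (φ r * θ ^ n) = monomial n r := by
  rw [← ev_monomial, Q_ev]

theorem Q_φ (h : IsSkewPolynomialRing α φ θ) (r : R) : Q h (φ r) = C r := by
  have := Q_mon h 0 r
  simpa using this

theorem Q_θ (h : IsSkewPolynomialRing α φ θ) : Q h θ = Polynomial.X := by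
  have := Q_mon h 1 1
  simpa [monomial_one_one_eq_X] using this

theorem θpow (h : IsSkewPolynomialRing α φ θ) (n : ℕ) (r : R) :
    θ ^ n * φ r = φ ((α ^ n) r) * θ ^ n := by
  induction n generalizing r with
  | zero => simp
  | succ n ih =>
    rw [pow_succ, mul_assoc, h.commutes, ← mul_assoc, ih, mul_assoc, pow_succ]
    rfl

theorem coeff_mul' (h : IsSkewPolynomialRing α φ θ) (a b : S) (n : ℕ) :
    (Q h (a * b)).coeff n =
      ∑ ij ∈ Finset.HasAntidiagonal.antidiagonal n, (Q h a).coeff ij.1 * (α ^ ij.1) ((Q h b).coeff ij.2) := by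
  classical
  obtain ⟨p, rfl⟩ := (ev_bij h).2 a
  obtain ⟨q, rfl⟩ := (ev_bij h).2 b
  rw [Q_ev, Q_ev]
  induction p using Polynomial.induction_on' with
  | add p p' hp hp' =>
    rw [map_add, add_mul, map_add, coeff_add, hp, hp', ← Finset.sum_add_distrib]
    simp [add_mul]
  | monomial i r =>
    induction q using Polynomial.induction_on' with
    | add p p' hp hp' =>
      rw [map_add, mul_add, map_add, coeff_add, hp, hp', ← Finset.sum_add_distrib]
      simp [mul_add]
    | monomial j s =>
      rw [ev_monomial, ev_monomial]
      have : φ r * θ ^ i * (φ s * θ ^ j) = φ (r * (α ^ i) s) * θ ^ (i + j) := by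
        rw [mul_assoc, ← mul_assoc (θ ^ i), θpow h, map_mul, pow_add]
        simp only [mul_assoc]
      rw [this, Q_mon, coeff_monomial]
      split_ifs with hn
      · subst hn
        rw [Finset.sum_eq_single (i, j)]
        · simp
        · rintro ⟨a, b⟩ hab hne
          rw [coeff_monomial]
          split_ifs with h1
          · dsimp only at h1
            subst h1
            exfalso
            apply hne
            rw [Finset.HasAntidiagonal.mem_antidiagonal] at hab
            ext <;> simp at *
            exact hab
          · simp
        · intro h1; simp at h1
      · symm
        apply Finset.sum_eq_zero
        rintro ⟨a, b⟩ hab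
        rw [Finset.HasAntidiagonal.mem_antidiagonal] at hab
        simp only [coeff_monomial]
        split_ifs with h1 h2
        · omega
        · simp
        · simp
        · simp

theorem coeff_φ_mul (h : IsSkewPolynomialRing α φ θ) (r : R) (a : S) (n : ℕ) :
    (Q h (φ r * a)).coeff n = r * (Q h a).coeff n := by
  rw [coeff_mul' h, Finset.sum_eq_single (0, n)]
  · rw [Q_φ]; simp
  · rintro ⟨i, j⟩ hij hne
    rw [Q_φ, coeff_C]
    split_ifs with h1
    · dsimp only at h1
      subst h1
      rw [Finset.HasAntidiagonal.mem_antidiagonal] at hij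
      simp at hij
      exact absurd (by rw [hij]) hne
    · simp
  · intro h1; simp at h1

theorem coeff_mul_φ (h : IsSkewPolynomialRing α φ θ) (r : R) (a : S) (n : ℕ) :
    (Q h (a * φ r)).coeff n = (Q h a).coeff n * (α ^ n) r := by
  rw [coeff_mul' h, Finset.sum_eq_single (n, 0)]
  · rw [Q_φ]; simp
  · rintro ⟨i, j⟩ hij hne
    rw [Q_φ, coeff_C]
    split_ifs with h1
    · dsimp only at h1
      subst h1
      rw [Finset.HasAntidiagonal.mem_antidiagonal] at hij
      simp at hij
      exact absurd (by rw [hij]) hne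
    · simp
  · intro h1; simp at h1

/-- the coefficients of a product above/at the sum of degree bounds. -/
theorem coeff_mul_top (h : IsSkewPolynomialRing α φ θ) (a b : S) (m n : ℕ)
    (ha : (Q h a).natDegree ≤ m) (hb : (Q h b).natDegree ≤ n) :
    (Q h (a * b)).coeff (m + n) = (Q h a).coeff m * (α ^ m) ((Q h b).coeff n) := by
  rw [coeff_mul' h, Finset.sum_eq_single (m, n)]
  · rintro ⟨i, j⟩ hij hne
    rw [Finset.HasAntidiagonal.mem_antidiagonal] at hij
    dsimp only at hij ⊢
    by_cases h1 : m < i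
    · rw [coeff_eq_zero_of_natDegree_lt (lt_of_le_of_lt ha h1), zero_mul]
    · have : n < j := by
        by_contra h2
        apply hne
        ext <;> simp <;> omega
      rw [coeff_eq_zero_of_natDegree_lt (lt_of_le_of_lt hb this), map_zero, mul_zero]
  · intro h1; simp at h1

theorem coeff_mul_gt (h : IsSkewPolynomialRing α φ θ) (a b : S) (m n i : ℕ)
    (ha : (Q h a).natDegree ≤ m) (hb : (Q h b).natDegree ≤ n) (hi : m + n < i) :
    (Q h (a * b)).coeff i = 0 := by
  rw [coeff_mul' h]
  apply Finset.sum_eq_zero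
  rintro ⟨p, q⟩ hij
  rw [Finset.HasAntidiagonal.mem_antidiagonal] at hij
  dsimp only at hij ⊢
  by_cases h1 : m < p
  · rw [coeff_eq_zero_of_natDegree_lt (lt_of_le_of_lt ha h1), zero_mul]
  · have : n < q := by omega
    rw [coeff_eq_zero_of_natDegree_lt (lt_of_le_of_lt hb this), map_zero, mul_zero]

variable [IsDomain R]

theorem Q_mul_ne (h : IsSkewPolynomialRing α φ θ) (a b : S) (ha : a ≠ 0) (hb : b ≠ 0) :
    (Q h (a * b)).natDegree = (Q h a).natDegree + (Q h b).natDegree ∧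
    (Q h (a * b)).leadingCoeff = (Q h a).leadingCoeff *
      (α ^ (Q h a).natDegree) (Q h b).leadingCoeff ∧ (Q h (a * b)).leadingCoeff ≠ 0 := by
  have e := coeff_mul_top h a b _ _ le_rfl le_rfl
  have hne : (Q h a).leadingCoeff * (α ^ (Q h a).natDegree) (Q h b).leadingCoeff ≠ 0 := by
    apply mul_ne_zero
    · simpa using ha
    · rw [Ne, EmbeddingLike.map_eq_zero_iff]
      simpa using hb
  have hd : (Q h (a * b)).natDegree = (Q h a).natDegree + (Q h b).natDegree := by
    apply le_antisymm
    · rw [natDegree_le_iff_coeff_eq_zero]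
      intro N hN
      exact coeff_mul_gt h a b _ _ N le_rfl le_rfl hN
    · apply le_natDegree_of_ne_zero
      rw [e]; exact hne
  have hl : (Q h (a * b)).leadingCoeff = (Q h a).leadingCoeff *
      (α ^ (Q h a).natDegree) (Q h b).leadingCoeff := by
    rw [← coeff_natDegree, hd, e]; rfl
  exact ⟨hd, hl, hl ▸ hne⟩

end SkewAux

namespace SkewAux

open Polynomial

variable {k R S : Type u} [Field k] [CommRing R] [IsDomain R] [IsDiscreteValuationRing R] [Ring S]
  {α : R ≃+* R} {φ : R →+* S} {θ : S}

theorem assoc_aut {X : R} (hX : Irreducible X) (β : R ≃+* R) (r : R) : Associated (β r) r := by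
  by_cases hr : r = 0
  · subst hr; simp
  obtain ⟨n, hn⟩ := IsDiscreteValuationRing.associated_pow_irreducible hr hX
  have h1 : Associated (β r) (β (X ^ n)) := hn.map β
  have h2 : Associated (β X) X :=
    IsDiscreteValuationRing.associated_of_irreducible R
      ((MulEquiv.irreducible_iff (β : R ≃* R)).2 hX) hX
  rw [map_pow] at h1
  exact h1.trans ((h2.pow_pow).trans hn.symm)

/-- The length function. -/
noncomputable def len (h : IsSkewPolynomialRing α φ θ) (s : S) : ℕ :=
  (Q h s).natDegree + (IsDiscreteValuationRing.addVal R (Q h s).leadingCoeff).toNat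

theorem Q_one (h : IsSkewPolynomialRing α φ θ) : Q h 1 = 1 := by
  have := Q_φ h 1
  simpa using this

theorem len_mul (h : IsSkewPolynomialRing α φ θ) {X : R} (hX : Irreducible X) (a b : S)
    (ha : a ≠ 0) (hb : b ≠ 0) : len h (a * b) = len h a + len h b := by
  obtain ⟨h1, h2, h3⟩ := Q_mul_ne h a b ha hb
  unfold len
  rw [h1, h2, IsDiscreteValuationRing.addVal_mul,
    (IsDiscreteValuationRing.addVal_eq_iff_associated _ _).2 (assoc_aut hX _ _),
    ENat.toNat_add]
  · ring
  · simpa [IsDiscreteValuationRing.addVal_eq_top_iff] using ha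
  · simpa [IsDiscreteValuationRing.addVal_eq_top_iff] using hb

theorem S_nzd (h : IsSkewPolynomialRing α φ θ) : NoZeroDivisors S where
  eq_zero_or_eq_zero_of_mul_eq_zero {a b} hab := by
    by_contra hc
    push Not at hc
    have := (Q_mul_ne h a b hc.1 hc.2).2.2
    rw [hab] at this
    simp at this

theorem S_nontriv (h : IsSkewPolynomialRing α φ θ) : Nontrivial S :=
  (Q h).toEquiv.nontrivial

theorem len_unit (h : IsSkewPolynomialRing α φ θ) {X : R} (hX : Irreducible X) (a : S)
    (ha : a ≠ 0) : len h a = 0 ↔ IsUnit a := by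
  have := S_nontriv h
  constructor
  · intro h0
    unfold len at h0
    have h1 : (Q h a).natDegree = 0 := by omega
    have h2 : (IsDiscreteValuationRing.addVal R (Q h a).leadingCoeff).toNat = 0 := by omega
    rw [ENat.toNat_eq_zero] at h2
    have h3 : IsUnit (Q h a).leadingCoeff := by
      rcases h2 with h2 | h2
      · exact IsDiscreteValuationRing.addVal_eq_zero_iff.1 h2
      · exfalso
        simp [IsDiscreteValuationRing.addVal_eq_top_iff] at h2
        exact ha h2
    have h4 : a = φ (Q h a).leadingCoeff := by
      apply (Q h).injective
      rw [Q_φ]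
      have := eq_C_of_natDegree_eq_zero h1
      rw [leadingCoeff, h1]
      exact this
    rw [h4]
    exact h3.map φ
  · rintro ⟨u, rfl⟩
    have h1 := len_mul h hX u (u⁻¹ : Sˣ) u.ne_zero (u⁻¹).ne_zero
    rw [Units.mul_inv] at h1
    have : len h (1 : S) = 0 := by
      unfold len
      rw [Q_one]
      simp
    omega

theorem Q_φ_ev (h : IsSkewPolynomialRing α φ θ) (r : R) (p : Polynomial R) :
    Q h (φ r * ev φ θ p) = C r * p := by
  ext n
  rw [coeff_φ_mul, Q_ev, coeff_C_mul]

theorem normal_aux (h : IsSkewPolynomialRing α φ θ) {X : R} (hX : Irreducible X) (s : S) :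
    ∃ t, φ X * s = t * φ X := by
  obtain ⟨p, rfl⟩ := (ev_bij h).2 s
  induction p using Polynomial.induction_on' with
  | add p q hp hq =>
    obtain ⟨t, ht⟩ := hp
    obtain ⟨t', ht'⟩ := hq
    exact ⟨t + t', by rw [map_add, mul_add, ht, ht', add_mul]⟩
  | monomial n r =>
    obtain ⟨v, hv⟩ := (assoc_aut hX (α ^ n)⁻¹ X).symm
    refine ⟨φ r * θ ^ n * φ v, ?_⟩
    rw [ev_monomial, mul_assoc _ (φ (v : R)), ← map_mul, mul_comm (v : R) X, hv, mul_assoc (φ r),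
      θpow h]
    have : (α ^ n) ((α ^ n)⁻¹ X) = X := (α ^ n).apply_symm_apply X
    rw [this, ← mul_assoc, ← mul_assoc, ← map_mul, ← map_mul, mul_comm]

theorem division_aux (h : IsSkewPolynomialRing α φ θ) {X : R} (hX : Irreducible X) (g : S)
    (hg : g ≠ 0) (n : ℕ) : ∀ a : S, (∀ i, (Q h g).natDegree + n ≤ i → (Q h a).coeff i = 0) →
    ∃ (N : ℕ) (b : S), ∀ i, (Q h g).natDegree ≤ i →
      (Q h (a * φ X ^ N - g * b)).coeff i = 0 := by
  induction n with
  | zero =>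
    intro a ha
    refine ⟨0, 0, fun i hi => ?_⟩
    simpa using ha i hi
  | succ n ih =>
    intro a ha
    set m := (Q h g).natDegree with hm
    have hg0 : (Q h g).coeff m ≠ 0 := by
      have : (Q h g).leadingCoeff ≠ 0 := by simpa using hg
      exact this
    obtain ⟨N0, hN0⟩ := IsDiscreteValuationRing.associated_pow_irreducible hg0 hX
    have h1 : (Q h g).coeff m ∣ (Q h a).coeff (m + n) * (α ^ (m + n)) (X ^ N0) := by
      apply Dvd.dvd.mul_left
      exact (hN0.trans (assoc_aut hX _ _).symm).dvd
    obtain ⟨d, hd⟩ := h1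
    let b0 : S := φ ((α ^ m)⁻¹ d) * θ ^ n
    have hb0 : Q h b0 = monomial n ((α ^ m)⁻¹ d) := Q_mon h _ _
    have hbd : (Q h b0).natDegree ≤ n := by rw [hb0]; exact natDegree_monomial_le _
    have key : ∀ i, m + n ≤ i → (Q h (a * φ X ^ N0 - g * b0)).coeff i = 0 := by
      intro i hi
      rw [map_sub, coeff_sub, ← map_pow, coeff_mul_φ]
      rcases hi.eq_or_lt with rfl | hi
      · rw [hd, coeff_mul_top h g b0 m n le_rfl hbd, hb0, coeff_monomial, if_pos rfl]
        have : (α ^ m) ((α ^ m)⁻¹ d) = d := (α ^ m).apply_symm_apply d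
        rw [this, sub_self]
      · rw [ha i (by omega), coeff_mul_gt h g b0 m n i le_rfl hbd hi, zero_mul, sub_zero]
    obtain ⟨N, b, hb⟩ := ih _ key
    refine ⟨N0 + N, b0 * φ X ^ N + b, fun i hi => ?_⟩
    rw [← hb i hi]
    congr 2
    rw [pow_add, sub_mul, mul_add]
    simp only [mul_assoc]
    abel

/-- reduction modulo `X`. -/
noncomputable def red (h : IsSkewPolynomialRing α φ θ) (ρ : R →+* k)
    (hρ : ∀ r, ρ (α r) = ρ r) : S →+* Polynomial k where
  toFun s := (Q h s).map ρ
  map_one' := by rw [Q_one]; simp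
  map_zero' := by simp
  map_add' a b := by simp
  map_mul' a b := by
    have hn : ∀ (n : ℕ) (r : R), ρ ((α ^ n) r) = ρ r := by
      intro n
      induction n with
      | zero => intro r; simp
      | succ n ih =>
        intro r
        rw [pow_succ]
        exact (ih (α r)).trans (hρ r)
    ext n
    rw [coeff_map, coeff_mul' h, coeff_mul, map_sum]
    apply Finset.sum_congr rfl
    intro ij _
    rw [map_mul, hn, coeff_map, coeff_map]

theorem facts (h : IsSkewPolynomialRing α φ θ) {X : R} (hX : Irreducible X) (ρ : R →+* k)
    (hρ : ∀ r, ρ (α r) = ρ r) (hρX : ∀ r, ρ r = 0 ↔ X ∣ r) (ι : k →+* R)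
    (hι : ∀ a, α (ι a) = ι a) (hρι : ∀ a, ρ (ι a) = a) :
    SkewFacts (φ X) (red h ρ hρ) (φ.comp ι) θ (len h) (fun s => (Q h s).natDegree) := by
  have hker : ∀ s : S, red h ρ hρ s = 0 ↔ ∃ t, s = φ X * t := by
    intro s
    constructor
    · intro hs
      have : C X ∣ Q h s := by
        rw [C_dvd_iff_dvd_coeff]
        intro i
        rw [← hρX]
        have := congrArg (fun p => p.coeff i) hs
        simpa [red] using this
      obtain ⟨p, hp⟩ := this
      refine ⟨ev φ θ p, ?_⟩
      apply (Q h).injective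
      rw [Q_φ_ev, hp]
    · rintro ⟨t, rfl⟩
      rw [map_mul]
      have : red h ρ hρ (φ X) = 0 := by
        simp [red, Q_φ, (hρX X).2 dvd_rfl]
      rw [this, zero_mul]
  have hxne : φ X ≠ 0 := by
    intro h0
    have := Q_φ h X
    rw [h0] at this
    simp at this
    exact hX.ne_zero (C_eq_zero.1 this.symm)
  have hx0 : red h ρ hρ (φ X) = 0 := by
    simp [red, Q_φ, (hρX X).2 dvd_rfl]
  refine ⟨S_nontriv h, S_nzd h, hker, hxne, ?_, normal_aux h hX, ?_, ?_, ?_, len_mul h hX,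
    len_unit h hX, ?_, ?_⟩
  · intro s
    rw [← hker, map_mul, hx0, mul_zero]
  · intro a s
    apply (Q h).injective
    ext n
    have hn : ∀ n : ℕ, (α ^ n) (ι a) = ι a := by
      intro n
      induction n with
      | zero => simp
      | succ n ih =>
        rw [pow_succ]
        show (α ^ n) (α (ι a)) = ι a
        rw [hι, ih]
    rw [RingHom.comp_apply, coeff_φ_mul, coeff_mul_φ, hn, mul_comm]
  · intro a
    simp [red, Q_φ, hρι]
  · simp [red, Q_θ]
  · intro s
    by_cases hs : s = 0
    · subst hs; simp
    · rw [(Q_mul_ne h s _ hs hxne).1, Q_φ]; simp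
  · intro g a hg
    obtain ⟨N, b, hb⟩ := division_aux h hX g hg ((Q h a).natDegree + 1) a (fun i hi =>
      coeff_eq_zero_of_natDegree_lt (by omega))
    refine ⟨N, b, a * φ X ^ N - g * b, by abel, ?_⟩
    by_cases hr : a * φ X ^ N - g * b = 0
    · exact Or.inl hr
    · right
      by_contra hlt
      push Not at hlt
      have := hb _ hlt
      have h2 : (Q h (a * φ X ^ N - g * b)).leadingCoeff = 0 := this
      rw [leadingCoeff_eq_zero] at h2
      exact hr ((map_eq_zero_iff _ (Q h).injective).1 h2)

end SkewAux

namespace ExtAux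

/-- Criterion for `Ext¹(P/Ap, V) = 0` for `P` free of rank one on `e`, `p = z • e` torsion-free. -/
theorem extVanish_iff {A : Type u} [Ring A] {P V : Type u} [AddCommGroup P] [Module A P]
    [AddCommGroup V] [Module A V] (e : P) (he : ∀ s : P, ∃ a : A, a • e = s)
    (he' : ∀ a : A, a • e = 0 → a = 0) (z : A) (p : P) (hp : z • e = p)
    (hreg : ∀ a : A, a • p = 0 → a = 0) :
    ExtVanish A (P ⧸ Submodule.span A {p}) V ↔ ∀ v : V, ∃ v' : V, z • v' = v := by
  constructor
  · intro H v
    let D : Submodule A (V × P) := Submodule.span A {(-v, p)}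
    let i : V →ₗ[A] ((V × P) ⧸ D) := D.mkQ.comp (LinearMap.inl A V P)
    let q : ((V × P) ⧸ D) →ₗ[A] (P ⧸ Submodule.span A {p}) :=
      D.liftQ ((Submodule.span A {p}).mkQ.comp (LinearMap.snd A V P)) (by
        rw [Submodule.span_le]
        rintro _ rfl
        simp only [SetLike.mem_coe, LinearMap.mem_ker, LinearMap.comp_apply, LinearMap.snd_apply,
          Submodule.mkQ_apply, Submodule.Quotient.mk_eq_zero]
        exact Submodule.mem_span_singleton_self p)
    have hi : Function.Injective i := by
      rw [injective_iff_map_eq_zero]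
      intro v0 h0
      have h0' : ((v0, 0) : V × P) ∈ D := by
        rw [← Submodule.Quotient.mk_eq_zero]; exact h0
      obtain ⟨a, ha⟩ := Submodule.mem_span_singleton.1 h0'
      have h1 : a • (-v) = v0 := congrArg Prod.fst ha
      have h2 : a • p = 0 := congrArg Prod.snd ha
      rw [hreg a h2, zero_smul] at h1
      exact h1.symm
    have hq : Function.Surjective q := by
      intro u
      obtain ⟨s, rfl⟩ := Submodule.Quotient.mk_surjective _ u
      exact ⟨D.mkQ (0, s), rfl⟩
    have hex : LinearMap.range i = LinearMap.ker q := by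
      apply le_antisymm
      · rintro _ ⟨v0, rfl⟩
        rw [LinearMap.mem_ker]
        show (Submodule.span A {p}).mkQ 0 = 0
        simp
      · intro y hy
        obtain ⟨⟨v0, s⟩, rfl⟩ := Submodule.Quotient.mk_surjective _ y
        have hs : s ∈ Submodule.span A {p} := by
          rw [← Submodule.Quotient.mk_eq_zero]
          exact hy
        obtain ⟨a, rfl⟩ := Submodule.mem_span_singleton.1 hs
        refine ⟨v0 + a • v, ?_⟩
        show Submodule.Quotient.mk (v0 + a • v, (0 : P)) = Submodule.Quotient.mk (v0, a • p)
        rw [Submodule.Quotient.eq]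
        rw [Submodule.mem_span_singleton]
        refine ⟨-a, ?_⟩
        ext <;> simp
    obtain ⟨r, hr⟩ := H _ i q hi hq hex
    refine ⟨r (D.mkQ (0, e)), ?_⟩
    rw [← map_smul, ← map_smul]
    have h1 : D.mkQ (z • ((0 : V), e)) = i v := by
      show Submodule.Quotient.mk (z • ((0 : V), e)) = Submodule.Quotient.mk (v, (0 : P))
      rw [Submodule.Quotient.eq, Submodule.mem_span_singleton]
      refine ⟨1, ?_⟩
      ext <;> simp [hp]
    rw [h1]
    exact LinearMap.congr_fun hr v
  · intro H Y _ _ i q hi hq hex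
    obtain ⟨y, hy⟩ := hq (Submodule.Quotient.mk e)
    have h1 : z • y ∈ LinearMap.ker q := by
      rw [LinearMap.mem_ker, map_smul, hy, ← Submodule.Quotient.mk_smul, hp,
        Submodule.Quotient.mk_eq_zero]
      exact Submodule.mem_span_singleton_self p
    rw [← hex] at h1
    obtain ⟨v, hv⟩ := h1
    obtain ⟨v', hv'⟩ := H v
    let y' := y - i v'
    have hzy : z • y' = 0 := by
      simp only [y', smul_sub, ← hv, ← map_smul, hv', sub_self]
    have hqi : ∀ v, q (i v) = 0 := fun v => by
      rw [← LinearMap.mem_ker, ← hex]; exact ⟨v, rfl⟩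
    have hqy : q y' = Submodule.Quotient.mk e := by
      simp [y', hqi, hy]
    have hdec : ∀ Y0 : Y, ∃ v : V, ∃ a : A, Y0 = i v + a • y' := by
      intro Y0
      obtain ⟨s, hs⟩ := Submodule.Quotient.mk_surjective _ (q Y0)
      obtain ⟨a, rfl⟩ := he s
      have : Y0 - a • y' ∈ LinearMap.ker q := by
        rw [LinearMap.mem_ker, map_sub, map_smul, hqy, ← hs, Submodule.Quotient.mk_smul, sub_self]
      rw [← hex] at this
      obtain ⟨v, hv⟩ := this
      exact ⟨v, a, by rw [hv]; abel⟩
    have hun : ∀ (v : V) (a : A), i v + a • y' = 0 → v = 0 := by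
      intro v a h0
      have h2 : q (i v + a • y') = 0 := by rw [h0, map_zero]
      rw [map_add, hqi, zero_add, map_smul, hqy, ← Submodule.Quotient.mk_smul,
        Submodule.Quotient.mk_eq_zero, Submodule.mem_span_singleton] at h2
      obtain ⟨b, hb⟩ := h2
      have hab : a = b * z := by
        have : (b * z - a) • e = 0 := by rw [sub_smul, mul_smul, hp, hb, sub_self]
        exact (sub_eq_zero.1 (he' _ this)).symm
      rw [hab, mul_smul, hzy, smul_zero, add_zero] at h0
      exact (map_eq_zero_iff i hi).1 h0
    choose f g hfg using hdec
    have huniq : ∀ (v : V) (a : A) (Y0 : Y), Y0 = i v + a • y' → f Y0 = v := by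
      intro v a Y0 h0
      have : i (f Y0 - v) + (g Y0 - a) • y' = 0 := by
        have h2 := hfg Y0
        rw [map_sub, sub_smul]
        have : i (f Y0) - i v + (g Y0 • y' - a • y') =
          (i (f Y0) + g Y0 • y') - (i v + a • y') := by abel
        rw [this, ← h2, ← h0, sub_self]
      exact sub_eq_zero.1 (hun _ _ this)
    refine ⟨{ toFun := f, map_add' := ?_, map_smul' := ?_ }, ?_⟩
    · intro Y1 Y2
      apply huniq _ (g Y1 + g Y2)
      conv_lhs => rw [hfg Y1, hfg Y2]
      rw [map_add, add_smul]; abel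
    · intro b Y1
      apply huniq _ (b * g Y1)
      conv_lhs => rw [hfg Y1]
      simp [mul_smul]
    · ext v
      exact huniq v 0 _ (by simp)

theorem mem_rSpan {S : Type u} [Ring S] (z s : S) : s ∈ rSpan S z ↔ ∃ a, s = z * a := by
  rw [Submodule.mem_span_singleton]
  constructor
  · rintro ⟨a, rfl⟩; exact ⟨a.unop, rfl⟩
  · rintro ⟨a, rfl⟩; exact ⟨op a, rfl⟩

theorem mem_lSpan {S : Type u} [Ring S] (z s : S) : s ∈ lSpan S z ↔ ∃ a, s = a * z := by
  rw [Submodule.mem_span_singleton]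
  constructor
  · rintro ⟨a, rfl⟩; exact ⟨a, rfl⟩
  · rintro ⟨a, rfl⟩; exact ⟨a, rfl⟩

theorem ext_right {S : Type u} [Ring S] (w z : S) (hz : ∀ a, z * a = 0 → a = 0) :
    ExtVanish Sᵐᵒᵖ (rQuot S z) (rQuot S w) ↔ ∀ s : S, ∃ a b, s = w * a + b * z := by
  rw [extVanish_iff (A := Sᵐᵒᵖ) (P := S) (V := rQuot S w) 1 (fun s => ⟨op s, by simp⟩)
    (fun a ha => by simpa using ha) (op z) z (by simp)
    (fun a ha => by
      rw [← op_unop a, hz a.unop ha]; rfl)]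
  constructor
  · intro H s
    obtain ⟨v', hv'⟩ := H (Submodule.Quotient.mk s)
    obtain ⟨b, rfl⟩ := Submodule.Quotient.mk_surjective _ v'
    rw [← Submodule.Quotient.mk_smul, Submodule.Quotient.eq, mem_rSpan] at hv'
    obtain ⟨a, ha⟩ := hv'
    refine ⟨-a, b, ?_⟩
    rw [mul_neg, ← ha]
    simp
  · intro H v
    obtain ⟨s, rfl⟩ := Submodule.Quotient.mk_surjective _ v
    obtain ⟨a, b, hab⟩ := H s
    refine ⟨Submodule.Quotient.mk b, ?_⟩
    rw [← Submodule.Quotient.mk_smul, Submodule.Quotient.eq, mem_rSpan]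
    exact ⟨-a, by rw [hab]; simp⟩

theorem ext_left {S : Type u} [Ring S] (w z : S) (hw : ∀ a, a * w = 0 → a = 0) :
    ExtVanish S (lQuot S w) (lQuot S z) ↔ ∀ s : S, ∃ a b, s = w * a + b * z := by
  rw [extVanish_iff (A := S) (P := S) (V := lQuot S z) 1 (fun s => ⟨s, by simp⟩)
    (fun a ha => by simpa using ha) w w (by simp) (fun a ha => hw a ha)]
  constructor
  · intro H s
    obtain ⟨v', hv'⟩ := H (Submodule.Quotient.mk s)
    obtain ⟨a, rfl⟩ := Submodule.Quotient.mk_surjective _ v'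
    rw [← Submodule.Quotient.mk_smul, Submodule.Quotient.eq, mem_lSpan] at hv'
    obtain ⟨b, hb⟩ := hv'
    refine ⟨a, -b, ?_⟩
    rw [neg_mul, ← hb]
    simp
  · intro H v
    obtain ⟨s, rfl⟩ := Submodule.Quotient.mk_surjective _ v
    obtain ⟨a, b, hab⟩ := H s
    refine ⟨Submodule.Quotient.mk a, ?_⟩
    rw [← Submodule.Quotient.mk_smul, Submodule.Quotient.eq, mem_lSpan]
    exact ⟨-b, by rw [hab]; simp⟩

end ExtAux

namespace HullAux

theorem exists_injective (A : Type u) [Ring A] (V : Type u) [AddCommGroup V] [Module A V] :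
    ∃ (E : Type u) (_ : AddCommGroup E) (_ : Module A E) (f : V →ₗ[A] E),
      Module.Injective A E ∧ Function.Injective f := by
  have : CategoryTheory.EnoughInjectives (ModuleCat.{u} A) := ModuleCat.enoughInjectives.{u, u} A
  let J := CategoryTheory.Injective.under (ModuleCat.of A V)
  refine ⟨J, inferInstance, inferInstance, (CategoryTheory.Injective.ι (ModuleCat.of A V)).hom, ?_, ?_⟩
  · have : CategoryTheory.Injective (ModuleCat.of A J) :=
      inferInstanceAs (CategoryTheory.Injective (CategoryTheory.Injective.under (ModuleCat.of A V)))
    exact Module.injective_module_of_injective_object A J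
  · exact (ModuleCat.mono_iff_injective _).1 inferInstance

theorem exists_hull (A : Type u) [Ring A] (V : Type u) [AddCommGroup V] [Module A V] :
    ∃ (E : Type u) (_ : AddCommGroup E) (_ : Module A E) (f : V →ₗ[A] E),
      IsInjectiveHullVia A f := by
  obtain ⟨E0, _, _, f, hE0, hf⟩ := exists_injective A V
  let U := LinearMap.range f
  let Z : Set (Submodule A E0) := {N | U ≤ N ∧ ∀ W : Submodule A E0, W ≤ N → W ≠ ⊥ → W ⊓ U ≠ ⊥}
  have hUZ : U ∈ Z := ⟨le_rfl, fun W hW hne => by rwa [inf_eq_left.2 hW]⟩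
  obtain ⟨N, hUN, hN⟩ := zorn_le_nonempty₀ Z (by
    intro c hc hchain y hy
    refine ⟨sSup c, ⟨le_trans (hc hy).1 (le_sSup hy), ?_⟩, fun z hz => le_sSup hz⟩
    intro W hW hne
    obtain ⟨w, hw, hw0⟩ := Submodule.exists_mem_ne_zero_of_ne_bot hne
    have h1 := hW hw
    rw [Submodule.mem_sSup_of_directed ⟨y, hy⟩ hchain.directedOn] at h1
    obtain ⟨N', hN', hwN'⟩ := h1
    have h2 := (hc hN').2 (Submodule.span A {w}) (by simpa using hwN') (by simpa using hw0)
    intro h3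
    apply h2
    rw [eq_bot_iff, ← h3]
    exact inf_le_inf_right _ (by simpa using hw)) U hUZ
  have hNZ : N ∈ Z := hN.prop
  let Z2 : Set (Submodule A E0) := {C | N ⊓ C = ⊥}
  obtain ⟨C, -, hC⟩ := zorn_le_nonempty₀ Z2 (by
    intro c hc hchain y hy
    refine ⟨sSup c, ?_, fun z hz => le_sSup hz⟩
    show N ⊓ sSup c = ⊥
    rw [eq_bot_iff]
    rintro x ⟨hx1, hx2⟩
    rw [SetLike.mem_coe, Submodule.mem_sSup_of_directed ⟨y, hy⟩ hchain.directedOn] at hx2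
    obtain ⟨N', hN', hxN'⟩ := hx2
    have : N ⊓ N' = ⊥ := hc hN'
    rw [← this]
    exact ⟨hx1, hxN'⟩) ⊥ (by simp [Z2])
  have hNC : N ⊓ C = ⊥ := hC.prop
  have hinj : Function.Injective (C.mkQ.comp N.subtype) := by
    rw [injective_iff_map_eq_zero]
    rintro ⟨x, hx⟩ h0
    have : x ∈ C := by
      rw [← Submodule.Quotient.mk_eq_zero]; exact h0
    have h1 : x ∈ N ⊓ C := ⟨hx, this⟩
    rw [hNC] at h1
    exact Subtype.ext h1
  obtain ⟨h, hh⟩ := hE0.out (C.mkQ.comp N.subtype) hinj N.subtype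
  have hhinj : ∀ y : E0, h (C.mkQ y) = 0 → y ∈ C := by
    intro y hy
    by_contra hyC
    let C' := C ⊔ Submodule.span A {y}
    have hlt : ¬ (N ⊓ C' = ⊥) := by
      intro h1
      have := hC.le_of_ge (show C' ∈ Z2 from h1) le_sup_left
      exact hyC (this (Submodule.mem_sup_right (Submodule.mem_span_singleton_self y)))
    obtain ⟨n, ⟨hn, hn'⟩, hn0⟩ := Submodule.exists_mem_ne_zero_of_ne_bot hlt
    rw [SetLike.mem_coe, Submodule.mem_sup] at hn'
    obtain ⟨c, hc, d, hd, rfl⟩ := hn'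
    obtain ⟨a, rfl⟩ := Submodule.mem_span_singleton.1 hd
    have h2 := hh ⟨c + a • y, hn⟩
    have h3 : (C.mkQ ∘ₗ N.subtype) ⟨c + a • y, hn⟩ = a • C.mkQ y := by
      show C.mkQ (c + a • y) = _
      rw [map_add, map_smul]
      have : C.mkQ c = 0 := by simpa using hc
      rw [this, zero_add]
    rw [h3, map_smul, hy, smul_zero] at h2
    exact hn0 h2.symm
  have hrange : LinearMap.range h ∈ Z := by
    have hNle : N ≤ LinearMap.range h := fun n hn => ⟨_, hh ⟨n, hn⟩⟩
    refine ⟨hUN.trans hNle, ?_⟩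
    intro W hW hne
    have h1 : W ⊓ N ≠ ⊥ := by
      obtain ⟨w, hw, hw0⟩ := Submodule.exists_mem_ne_zero_of_ne_bot hne
      obtain ⟨y', hy'⟩ := hW hw
      obtain ⟨y, rfl⟩ := Submodule.mkQ_surjective C y'
      have hyC : y ∉ C := by
        intro hyC
        have : C.mkQ y = 0 := by simpa using hyC
        rw [this, map_zero] at hy'
        exact hw0 hy'.symm
      let C' := C ⊔ Submodule.span A {y}
      have hlt : ¬ (N ⊓ C' = ⊥) := by
        intro h1
        have := hC.le_of_ge (show C' ∈ Z2 from h1) le_sup_left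
        exact hyC (this (Submodule.mem_sup_right (Submodule.mem_span_singleton_self y)))
      obtain ⟨n, ⟨hn, hn'⟩, hn0⟩ := Submodule.exists_mem_ne_zero_of_ne_bot hlt
      rw [SetLike.mem_coe, Submodule.mem_sup] at hn'
      obtain ⟨c, hc, d, hd, rfl⟩ := hn'
      obtain ⟨a, rfl⟩ := Submodule.mem_span_singleton.1 hd
      have h2 := hh ⟨c + a • y, hn⟩
      have h3 : (C.mkQ ∘ₗ N.subtype) ⟨c + a • y, hn⟩ = a • C.mkQ y := by
        show C.mkQ (c + a • y) = _
        rw [map_add, map_smul]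
        have : C.mkQ c = 0 := by simpa using hc
        rw [this, zero_add]
      rw [h3, map_smul, hy'] at h2
      have h2' : a • w = c + a • y := h2
      intro hbot
      have : a • w ∈ W ⊓ N := ⟨W.smul_mem a hw, h2' ▸ hn⟩
      rw [hbot, Submodule.mem_bot, h2'] at this
      exact hn0 this
    have h2 := hNZ.2 (W ⊓ N) inf_le_right h1
    intro h3
    apply h2
    rw [eq_bot_iff, ← h3]
    exact inf_le_inf_right _ inf_le_left
  have hrangeN : LinearMap.range h = N := by
    apply le_antisymm
    · exact hN.le_of_ge hrange (fun n hn => ⟨_, hh ⟨n, hn⟩⟩)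
    · exact fun n hn => ⟨_, hh ⟨n, hn⟩⟩
  let r : E0 →ₗ[A] N := (h.comp C.mkQ).codRestrict N (fun y => by
    rw [← hrangeN]; exact ⟨_, rfl⟩)
  have hr : ∀ n : N, r n = n := fun n => Subtype.ext (hh n)
  refine ⟨N, inferInstance, inferInstance, f.codRestrict N (fun v => hUN ⟨v, rfl⟩), ?_, ?_, ?_⟩
  · refine ⟨fun X Y _ _ _ _ i hi g => ?_⟩
    obtain ⟨g', hg'⟩ := hE0.out i hi (N.subtype.comp g)
    refine ⟨r.comp g', fun x => ?_⟩
    rw [LinearMap.comp_apply, hg']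
    exact hr (g x)
  · intro a b hab
    exact hf (congrArg Subtype.val hab)
  · intro W hW hbot
    have h1 : W.map N.subtype ≠ ⊥ := by
      intro h1
      apply hW
      rw [eq_bot_iff]
      intro w hw
      have h2 : (w : E0) ∈ W.map N.subtype := ⟨w, hw, rfl⟩
      rw [h1] at h2
      exact Subtype.ext h2
    apply hNZ.2 (W.map N.subtype) (Submodule.map_subtype_le N W) h1
    rw [eq_bot_iff]
    rintro _ ⟨⟨w, hw, rfl⟩, ⟨v, hv⟩⟩
    have : w ∈ W ⊓ LinearMap.range (f.codRestrict N (fun v => hUN ⟨v, rfl⟩)) :=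
      ⟨hw, v, Subtype.ext hv⟩
    rw [hbot, Submodule.mem_bot] at this
    rw [this]
    simp

end HullAux

namespace SkewFacts

open Polynomial

variable {k S : Type u} [Field k] [Ring S] {x : S} {π : S →+* Polynomial k}
    {c : k →+* S} {θ : S} {ℓ deg : S → ℕ}

theorem pix (H : SkewFacts x π c θ ℓ deg) : π x = 0 := (H.ker x).2 ⟨1, by simp⟩

theorem x_nonunit (H : SkewFacts x π c θ ℓ deg) : ¬ IsUnit x := by
  intro h
  have := h.map π
  rw [H.pix] at this
  exact not_isUnit_zero this

theorem ker' (H : SkewFacts x π c θ ℓ deg) (s : S) (hs : π s = 0) : ∃ t, s = t * x := by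
  obtain ⟨t, rfl⟩ := (H.ker s).1 hs
  exact H.normal2 t

theorem npow1 (H : SkewFacts x π c θ ℓ deg) (n : ℕ) (s : S) : ∃ t, s * x ^ n = x ^ n * t := by
  induction n generalizing s with
  | zero => exact ⟨s, by simp⟩
  | succ n ih =>
    obtain ⟨t, ht⟩ := ih s
    obtain ⟨t', ht'⟩ := H.normal1 t
    exact ⟨t', by rw [pow_succ, ← mul_assoc, ht, mul_assoc, ht', mul_assoc]⟩

theorem npow2 (H : SkewFacts x π c θ ℓ deg) (n : ℕ) (s : S) : ∃ t, x ^ n * s = t * x ^ n := by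
  induction n generalizing s with
  | zero => exact ⟨s, by simp⟩
  | succ n ih =>
    obtain ⟨t', ht'⟩ := H.normal2 s
    obtain ⟨t, ht⟩ := ih t'
    exact ⟨t, by rw [pow_succ, mul_assoc, ht', ← mul_assoc, ht, mul_assoc]⟩

theorem cancel_pow (H : SkewFacts x π c θ ℓ deg) (g : S) (hg : π g ≠ 0) (n : ℕ) :
    ∀ a b : S, a * x ^ n = g * b → ∃ b', a = g * b' := by
  have := H.nzd
  induction n with
  | zero => intro a b h; exact ⟨b, by simpa using h⟩
  | succ n ih =>
    intro a b h
    have h1 : π g * π b = 0 := by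
      rw [← map_mul, ← h, map_mul, map_pow, H.pix, zero_pow (Nat.succ_ne_zero n), mul_zero]
    have h2 : π b = 0 := (mul_eq_zero.1 h1).resolve_left hg
    obtain ⟨t, rfl⟩ := H.ker' b h2
    apply ih a t
    rw [pow_succ, ← mul_assoc, ← mul_assoc] at h
    exact mul_right_cancel₀ H.xne h

theorem saturated_principal (H : SkewFacts x π c θ ℓ deg) (J : Submodule Sᵐᵒᵖ S)
    (hsat : ∀ s, s * x ∈ J → s ∈ J) :
    ∃ g ∈ J, (∀ a ∈ J, ∃ b, a = g * b) ∧ (g = 0 ∨ π g ≠ 0) := by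
  have := H.nzd
  by_cases hJ : J = ⊥
  · subst hJ
    refine ⟨0, by simp, ?_, Or.inl rfl⟩
    intro a ha
    exact ⟨0, by simpa using ha⟩
  obtain ⟨g1, hg1, hg10⟩ := Submodule.exists_mem_ne_zero_of_ne_bot hJ
  obtain ⟨g0, ⟨hg0, hg00⟩, hmin0⟩ := WellFounded.has_min (InvImage.wf deg Nat.lt_wfRel.wf)
    {g : S | g ∈ J ∧ g ≠ 0} ⟨g1, hg1, hg10⟩
  obtain ⟨g, ⟨hg, hgne, hgd⟩, hmin⟩ := WellFounded.has_min (InvImage.wf ℓ Nat.lt_wfRel.wf)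
    {g : S | g ∈ J ∧ g ≠ 0 ∧ deg g = deg g0} ⟨g0, hg0, hg00, rfl⟩
  have hπ : π g ≠ 0 := by
    intro h0
    obtain ⟨t, rfl⟩ := H.ker' g h0
    have ht : t ≠ 0 := left_ne_zero_of_mul hgne
    refine hmin t ⟨hsat t hg, ht, ?_⟩ ?_
    · rw [← hgd, H.degx]
    · show ℓ t < ℓ (t * x)
      rw [H.ℓmul t x ht H.xne]
      have : ℓ x ≠ 0 := fun h => H.x_nonunit ((H.ℓunit x H.xne).1 h)
      omega
  refine ⟨g, hg, ?_, Or.inr hπ⟩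
  intro a ha
  obtain ⟨N, b, r, hr, hr'⟩ := H.division g a hgne
  have hrJ : r ∈ J := by
    have h1 : a * x ^ N ∈ J := J.smul_mem (op (x ^ N)) ha
    have h2 : g * b ∈ J := J.smul_mem (op b) hg
    have : r = a * x ^ N - g * b := by rw [hr]; abel
    rw [this]
    exact J.sub_mem h1 h2
  rcases hr' with rfl | hlt
  · rw [add_zero] at hr
    exact H.cancel_pow g hπ N a b hr
  · by_cases hr0 : r = 0
    · subst hr0
      rw [add_zero] at hr
      exact H.cancel_pow g hπ N a b hr
    · exfalso
      refine hmin0 r ⟨hrJ, hr0⟩ ?_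
      show deg r < deg g0
      omega

theorem xpow_mem (H : SkewFacts x π c θ ℓ deg) (p y : S) (hp : Irreducible p) (hπp : π p ≠ 0)
    (hy : ¬ ∃ b, y = p * b) : ∃ (m : ℕ) (a b : S), x ^ m = p * a + y * b := by
  let J : Submodule Sᵐᵒᵖ S :=
    { carrier := {s | ∃ (m : ℕ) (a b : S), s * x ^ m = p * a + y * b}
      zero_mem' := ⟨0, 0, 0, by simp⟩
      add_mem' := by
        rintro s s' ⟨m, a, b, h⟩ ⟨m', a', b', h'⟩
        refine ⟨m + m', a * x ^ m' + a' * x ^ m, b * x ^ m' + b' * x ^ m, ?_⟩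
        rw [add_mul, pow_add, ← mul_assoc, h, ← pow_add, add_comm m m', pow_add, ← mul_assoc, h']
        simp only [mul_add, add_mul, mul_assoc]
        abel
      smul_mem' := by
        rintro r s ⟨m, a, b, h⟩
        obtain ⟨t, ht⟩ := H.npow1 m r.unop
        refine ⟨m, a * t, b * t, ?_⟩
        show s * r.unop * x ^ m = _
        rw [mul_assoc, ht, ← mul_assoc, h, add_mul, mul_assoc, mul_assoc] }
  have hsat : ∀ s, s * x ∈ J → s ∈ J := by
    rintro s ⟨m, a, b, h⟩
    exact ⟨m + 1, a, b, by rw [pow_succ', ← mul_assoc, h]⟩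
  obtain ⟨g, hg, hall, -⟩ := H.saturated_principal J hsat
  have hpJ : p ∈ J := ⟨0, 1, 0, by simp⟩
  have hyJ : y ∈ J := ⟨0, 0, 1, by simp⟩
  obtain ⟨b, hb⟩ := hall p hpJ
  rcases hp.isUnit_or_isUnit hb with hu | hu
  · obtain ⟨m, a, b, h⟩ := J.smul_mem (op (hu.unit⁻¹ : Sˣ).1) hg
    refine ⟨m, a, b, ?_⟩
    rw [← h]
    show _ = g * (hu.unit⁻¹ : Sˣ).1 * x ^ m
    rw [IsUnit.mul_val_inv, one_mul]
  · exfalso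
    apply hy
    obtain ⟨d, hd⟩ := hall y hyJ
    refine ⟨(hu.unit⁻¹ : Sˣ).1 * d, ?_⟩
    rw [hb, mul_assoc, ← mul_assoc b, IsUnit.mul_val_inv, one_mul, hd]

theorem B_div (H : SkewFacts x π c θ ℓ deg) (w : S) (hw : IsUnit (π w)) (n : ℕ) :
    ∀ s : S, ∃ a b, s = w * a + b * x ^ n := by
  have one : ∀ s : S, ∃ a b, s = w * a + b * x := by
    intro s
    obtain ⟨r, hr, hr'⟩ := Polynomial.isUnit_iff.1 hw
    have hr0 : r ≠ 0 := hr.ne_zero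
    have h1 : π (s - w * (c r⁻¹ * s)) = 0 := by
      rw [map_sub, map_mul, map_mul, ← hr', H.pic, ← mul_assoc, ← C_mul, mul_inv_cancel₀ hr0]
      simp
    obtain ⟨t, ht⟩ := H.ker' _ h1
    exact ⟨c r⁻¹ * s, t, by rw [← ht]; abel⟩
  induction n with
  | zero => intro s; exact ⟨0, s, by simp⟩
  | succ n ih =>
    intro s
    obtain ⟨a, b, h⟩ := ih s
    obtain ⟨a', b', h'⟩ := one b
    refine ⟨a + a' * x ^ n, b', ?_⟩
    rw [h]
    conv_lhs => rw [h']
    rw [pow_succ']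
    simp only [mul_add, add_mul, mul_assoc]
    abel

theorem exists_factor (H : SkewFacts x π c θ ℓ deg) (n : ℕ) : ∀ g : S, ℓ g = n → g ≠ 0 →
    ¬ IsUnit g → ∃ p t, Irreducible p ∧ g = p * t ∧ ℓ t < ℓ g ∧ t ≠ 0 := by
  have := H.nzd
  induction n using Nat.strong_induction_on with
  | _ n ih =>
    intro g hg hg0 hu
    have key : ∀ p t, Irreducible p → g = p * t → ℓ t < ℓ g ∧ t ≠ 0 := by
      intro p t hp hgt
      have hp0 : p ≠ 0 := by rintro rfl; simp at hgt; exact hg0 hgt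
      have ht0 : t ≠ 0 := by rintro rfl; simp at hgt; exact hg0 hgt
      refine ⟨?_, ht0⟩
      rw [hgt, H.ℓmul p t hp0 ht0]
      have : ℓ p ≠ 0 := fun h => hp.not_isUnit ((H.ℓunit p hp0).1 h)
      omega
    suffices ∃ p t, Irreducible p ∧ g = p * t by
      obtain ⟨p, t, hp, ht⟩ := this
      exact ⟨p, t, hp, ht, key p t hp ht⟩
    by_cases hirr : Irreducible g
    · exact ⟨g, 1, hirr, by simp⟩
    · rw [irreducible_iff] at hirr
      push Not at hirr
      obtain ⟨a, b, hab, ha, hb⟩ := hirr hu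
      have ha0 : a ≠ 0 := by rintro rfl; simp at hab; exact hg0 hab
      have hb0 : b ≠ 0 := by rintro rfl; simp at hab; exact hg0 hab
      have : ℓ b ≠ 0 := fun h => hb ((H.ℓunit b hb0).1 h)
      have hl := H.ℓmul a b ha0 hb0
      rw [← hab] at hl
      obtain ⟨p, t, hp, hat, -⟩ := ih (ℓ a) (by omega) a rfl ha0 ha
      exact ⟨p, t * b, hp, by rw [hab, hat, mul_assoc]⟩

theorem simple_B (H : SkewFacts x π c θ ℓ deg) (w : S) (hw : Irreducible w)
    (hπ : IsUnit (π w)) : IsSimpleModule Sᵐᵒᵖ (rQuot S w) := by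
  have := H.nzd
  have := H.nontriv
  rw [isSimpleModule_iff_toSpanSingleton_surjective]
  constructor
  · refine ⟨Submodule.Quotient.mk 1, 0, ?_⟩
    rw [Ne, Submodule.Quotient.mk_eq_zero, ExtAux.mem_rSpan]
    rintro ⟨a, ha⟩
    rcases hw.isUnit_or_isUnit (show w = w * (a * w) by rw [← mul_assoc, ← ha, one_mul]) with h | h
    · exact hw.not_isUnit h
    · apply hw.not_isUnit
      exact isUnit_iff_exists.2 ⟨a, ha.symm, by
        have : w * (a * w - 1) = 0 := by rw [mul_sub, ← mul_assoc, ← ha]; simp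
        rcases mul_eq_zero.1 this with h | h
        · exact absurd h hw.ne_zero
        · exact sub_eq_zero.1 h⟩
  · intro m hm m'
    obtain ⟨y, rfl⟩ := Submodule.Quotient.mk_surjective _ m
    obtain ⟨s, rfl⟩ := Submodule.Quotient.mk_surjective _ m'
    rw [Ne, Submodule.Quotient.mk_eq_zero, ExtAux.mem_rSpan] at hm
    obtain ⟨n, a, b, h⟩ := H.xpow_mem w y hw hπ.ne_zero hm
    obtain ⟨a', b', h'⟩ := H.B_div w hπ n s
    obtain ⟨t, ht⟩ := H.npow1 n b'
    refine ⟨op (b * t), ?_⟩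
    rw [LinearMap.toSpanSingleton_apply, ← Submodule.Quotient.mk_smul, Submodule.Quotient.eq,
      ExtAux.mem_rSpan]
    refine ⟨-(a' + a * t), ?_⟩
    rw [h', ht, h]
    show y * (b * t) - _ = _
    simp only [mul_add, add_mul, mul_assoc, mul_neg]
    abel

theorem diamond_imp (H : SkewFacts x π c θ ℓ deg) (hd : HasDiamond Sᵐᵒᵖ) (w z : S)
    (hw : Irreducible w) (hπw : IsUnit (π w)) (hz : Irreducible z) (hz0 : π z ≠ 0)
    (hzu : ¬ IsUnit (π z)) (s : S) : ∃ a b, s = w * a + b * z := by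
  have := H.nzd
  have := H.nontriv
  obtain ⟨E, _, _, f, hf⟩ := HullAux.exists_hull Sᵐᵒᵖ (rQuot S w)
  have hart := hd _ E f (H.simple_B w hw hπw) hf
  obtain ⟨hinj, hfi, -⟩ := hf
  let v : S → rQuot S w := Submodule.Quotient.mk
  have hv : ∀ s t : S, op t • v s = v (s * t) := fun s t => rfl
  have hact : ∀ (e : E) (s t : S), op t • op s • e = op (s * t) • e := fun e s t => by
    rw [smul_smul, ← op_mul]
  let i : S →ₗ[Sᵐᵒᵖ] S :=
    { toFun := fun t => z * t
      map_add' := fun a b => mul_add _ _ _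
      map_smul' := fun a b => (mul_assoc z b a.unop).symm }
  have hi : Function.Injective i := fun a b hab => mul_left_cancel₀ hz.ne_zero hab
  let g : S →ₗ[Sᵐᵒᵖ] E :=
    { toFun := fun t => op t • f (v s)
      map_add' := fun a b => by rw [op_add, add_smul]
      map_smul' := fun a b => by
        show op (b * a.unop) • f (v s) = a • op b • f (v s)
        rw [← hact]; rfl }
  obtain ⟨h, hh⟩ := hinj.out i hi g
  let e := h 1
  have he : op z • e = f (v s) := by
    have h1 := hh 1
    have h2 : g 1 = f (v s) := by show op (1 : S) • f (v s) = _; simp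
    rw [h2] at h1
    rw [← h1, ← map_smul]
    congr 1
    show 1 * z = z * 1
    simp
  have hA := hart (Submodule.span Sᵐᵒᵖ {e}) (Submodule.fg_span_singleton e)
  let e0 : Submodule.span Sᵐᵒᵖ {e} := ⟨e, Submodule.mem_span_singleton_self e⟩
  obtain ⟨n, hn⟩ := IsArtinian.monotone_stabilizes
    (⟨fun n => OrderDual.toDual (Submodule.span Sᵐᵒᵖ {(op (x ^ n)) • e0}), by
      apply monotone_nat_of_le_succ
      intro n
      show Submodule.span Sᵐᵒᵖ {(op (x ^ (n + 1))) • e0} ≤ Submodule.span Sᵐᵒᵖ {(op (x ^ n)) • e0}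
      rw [Submodule.span_singleton_le_iff_mem, Submodule.mem_span_singleton]
      refine ⟨op x, ?_⟩
      rw [smul_smul, ← op_mul, pow_succ]⟩ :
        ℕ →o (Submodule Sᵐᵒᵖ (Submodule.span Sᵐᵒᵖ {e}))ᵒᵈ)
  have hn1 : Submodule.span Sᵐᵒᵖ {(op (x ^ n)) • e0} =
    Submodule.span Sᵐᵒᵖ {(op (x ^ (n + 1))) • e0} := hn (n + 1) (Nat.le_succ n)
  have hmem : (op (x ^ n)) • e0 ∈ Submodule.span Sᵐᵒᵖ {(op (x ^ (n + 1))) • e0} := by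
    rw [← hn1]; exact Submodule.mem_span_singleton_self _
  obtain ⟨t, ht⟩ := Submodule.mem_span_singleton.1 hmem
  have ht' : op (x ^ (n + 1) * t.unop) • e = op (x ^ n) • e := by
    rw [← hact]
    exact congrArg Subtype.val ht
  obtain ⟨t', ht2⟩ := H.npow2 n t.unop
  let y := x ^ n - x ^ (n + 1) * t.unop
  have hy0 : op y • e = 0 := by rw [op_sub, sub_smul, ht', sub_self]
  have hy : ¬ ∃ b, y = z * b := by
    rintro ⟨b, hb⟩
    have h1 : y = (1 - x * t') * x ^ n := by
      simp only [y]
      rw [sub_mul, one_mul, mul_assoc, ← ht2, pow_succ', mul_assoc]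
    rw [h1] at hb
    obtain ⟨b', hb'⟩ := H.cancel_pow z hz0 n _ _ hb
    have h2 := congrArg π hb'
    rw [map_sub, map_one, map_mul, H.pix, zero_mul, sub_zero, map_mul] at h2
    exact hzu (IsUnit.of_mul_eq_one _ h2.symm)
  obtain ⟨m, a, b, hab⟩ := H.xpow_mem z y hz hz0 hy
  obtain ⟨a1, b1, h1⟩ := H.B_div w hπw m (s * a)
  have hex : op (x ^ m) • (e - f (v b1)) = 0 := by
    have hex1 : op (x ^ m) • e = op a • f (v s) := by
      rw [hab, op_add, add_smul, ← hact, ← hact, he, hy0, smul_zero, add_zero]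
    rw [smul_sub, hex1, ← map_smul, ← map_smul, hv, hv, h1, ← map_sub]
    have : v (w * a1 + b1 * x ^ m) - v (b1 * x ^ m) = 0 := by
      show Submodule.Quotient.mk _ - Submodule.Quotient.mk _ = _
      rw [← Submodule.Quotient.mk_sub, Submodule.Quotient.mk_eq_zero, ExtAux.mem_rSpan]
      exact ⟨a1, by abel⟩
    rw [this, map_zero]
  obtain ⟨z', hz'⟩ := H.npow1 m z
  have h3 : op (x ^ m) • op z • (e - f (v b1)) = 0 := by
    rw [hact, hz', ← hact, hex, smul_zero]
  rw [smul_sub, he, ← map_smul, hv, ← map_sub, ← map_smul] at h3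
  have h4 := (map_eq_zero_iff f hfi).1 h3
  have h5 : (s - b1 * z) * x ^ m ∈ rSpan S w := by
    rw [← Submodule.Quotient.mk_eq_zero]
    exact h4
  rw [ExtAux.mem_rSpan] at h5
  obtain ⟨a2, h6⟩ := h5
  obtain ⟨a3, h7⟩ := H.cancel_pow w hπw.ne_zero m _ _ h6
  exact ⟨a3, b1, by rw [← h7]; abel⟩

end SkewFacts

namespace SkewFacts

open Polynomial

variable {k S : Type u} [Field k] [Ring S] {x : S} {π : S →+* Polynomial k}
    {c : k →+* S} {θ : S} {ℓ deg : S → ℕ}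
    {E : Type u} [AddCommGroup E] [Module Sᵐᵒᵖ E]

theorem act (e : E) (s t : S) : op t • op s • e = op (s * t) • e := by
  rw [smul_smul, ← op_mul]

theorem lift_poly (H : SkewFacts x π c θ ℓ deg) (q : Polynomial k) :
    π (∑ j ∈ Finset.range (q.natDegree + 1), c (q.coeff j) * θ ^ j) = q := by
  rw [map_sum]
  conv_rhs => rw [q.as_sum_range_C_mul_X_pow]
  apply Finset.sum_congr rfl
  intro j _
  rw [map_mul, map_pow, H.pic, H.piθ]

/-- An element killed by a power of `x` and by some `h` outside `xS` generates an Artinian module. -/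
theorem artinian_of_killed (H : SkewFacts x π c θ ℓ deg) (e : E) (n : ℕ)
    (hn : op (x ^ n) • e = 0) (h : S) (hh : π h ≠ 0) (heh : op h • e = 0) :
    IsArtinian Sᵐᵒᵖ (Submodule.span Sᵐᵒᵖ {e}) := by
  let c' : k →+* Sᵐᵒᵖ :=
    { toFun := fun a => op (c a)
      map_one' := by simp
      map_mul' := fun a b => by rw [mul_comm a b, map_mul, op_mul]
      map_zero' := by simp
      map_add' := fun a b => by rw [map_add, op_add] }
  letI : Module k E := Module.compHom E c'
  letI : Module k Sᵐᵒᵖ := Module.compHom Sᵐᵒᵖ c'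
  have hk : ∀ (a : k) (y : E), a • y = op (c a) • y := fun a y => rfl
  haveI : IsScalarTower k Sᵐᵒᵖ E := ⟨fun a b y => by
    show (op (c a) * b) • y = op (c a) • b • y
    rw [mul_smul]⟩
  let d := (π h).natDegree
  let F : Submodule k E := Submodule.span k
    (Set.image (fun ji : ℕ × ℕ => op (θ ^ ji.1 * x ^ ji.2) • e)
      ((Finset.range d ×ˢ Finset.range n : Finset (ℕ × ℕ)) : Set (ℕ × ℕ)))
  have hF : ∀ j i, j < d → i < n → op (θ ^ j * x ^ i) • e ∈ F := by
    intro j i hj hi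
    apply Submodule.subset_span
    exact ⟨(j, i), by simp [hj, hi], rfl⟩
  have claim : ∀ m, m ≤ n → ∀ s : S, op (s * x ^ (n - m)) • e ∈ F := by
    intro m
    induction m with
    | zero =>
      intro _ s
      obtain ⟨t, ht⟩ := H.npow1 n s
      rw [Nat.sub_zero, ht, ← act, hn, smul_zero]
      exact F.zero_mem
    | succ m ih =>
      intro hm s
      set i := n - (m + 1) with hi
      have hi1 : n - m = i + 1 := by omega
      obtain ⟨t, ht⟩ : ∃ t, π t = π s / π h := ⟨_, H.lift_poly _⟩
      let r := π s % π h
      let r' : S := ∑ j ∈ Finset.range d, c (r.coeff j) * θ ^ j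
      have hr' : π r' = r := by
        have hdeg : r.degree < (π h).degree := EuclideanDomain.mod_lt _ hh
        ext j
        rw [map_sum, finsetSum_coeff]
        simp only [map_mul, map_pow, H.pic, H.piθ, coeff_C_mul, coeff_X_pow]
        by_cases hj : j < d
        · rw [Finset.sum_eq_single j]
          · simp
          · intro b _ hb
            rw [if_neg (Ne.symm hb), mul_zero]
          · intro h1
            simp at h1; omega
        · rw [Finset.sum_eq_zero]
          · symm
            apply coeff_eq_zero_of_degree_lt
            apply lt_of_lt_of_le hdeg
            rw [degree_eq_natDegree hh]
            exact_mod_cast not_lt.1 hj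
          · intro b hb
            simp at hb
            rw [if_neg (by omega), mul_zero]
      have h0 : π (s - h * t - r') = 0 := by
        rw [map_sub, map_sub, map_mul, ht, hr']
        have := EuclideanDomain.div_add_mod (π s) (π h)
        rw [sub_sub, sub_eq_zero]
        exact this.symm
      obtain ⟨b, hb⟩ := H.ker' _ h0
      have hs : s * x ^ i = h * (t * x ^ i) + r' * x ^ i + b * x ^ (n - m) := by
        have : s = h * t + r' + b * x := by rw [← hb]; abel
        conv_lhs => rw [this]
        rw [hi1, pow_succ']
        simp only [add_mul, mul_assoc]
      rw [hs, op_add, add_smul, op_add, add_smul, ← act, heh, smul_zero, zero_add]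
      apply F.add_mem _ (ih (by omega) b)
      simp only [r']
      rw [Finset.sum_mul, Finset.op_sum, Finset.sum_smul]
      apply F.sum_mem
      intro j hj
      rw [mul_assoc, H.central, ← act, ← hk]
      exact F.smul_mem _ (hF j i (by simpa using hj) (by omega))
  have hfin : IsArtinian k F := by
    have : Module.Finite k F := Module.Finite.span_of_finite k
      (Set.Finite.image _ (Finset.finite_toSet _))
    infer_instance
  have hle : (Submodule.span Sᵐᵒᵖ {e}).restrictScalars k ≤ F := by
    intro y hy
    obtain ⟨a, rfl⟩ := Submodule.mem_span_singleton.1 hy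
    have := claim n le_rfl a.unop
    simpa using this
  have h1 : IsArtinian k ((Submodule.span Sᵐᵒᵖ {e}).restrictScalars k) :=
    isArtinian_of_le hle
  exact isArtinian_of_tower k (M := Submodule.span Sᵐᵒᵖ {e}) h1

/-- the torsion case. -/
theorem case_one (H : SkewFacts x π c θ ℓ deg) (U : Submodule Sᵐᵒᵖ E)
    (hess : ∀ e : E, e ≠ 0 → ∃ s : S, op s • e ∈ U ∧ op s • e ≠ 0)
    (hsim : ∀ u ∈ U, u ≠ 0 → ∀ u' ∈ U, ∃ s : S, op s • u = u')
    (hUx : ∀ u ∈ U, op x • u = 0) (e : E) :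
    IsArtinian Sᵐᵒᵖ (Submodule.span Sᵐᵒᵖ {e}) := by
  have := H.nzd
  have hA : ∀ e : E, ∃ n, op (x ^ n) • e = 0 := by
    intro e
    let J : Submodule Sᵐᵒᵖ S :=
      { carrier := {s | ∃ n : ℕ, op (s * x ^ n) • e = 0}
        zero_mem' := ⟨0, by simp⟩
        add_mem' := by
          rintro s s' ⟨m, h⟩ ⟨m', h'⟩
          refine ⟨m + m', ?_⟩
          rw [add_mul, op_add, add_smul, pow_add, ← mul_assoc, ← act, h, ← pow_add, add_comm m m',
            pow_add, ← mul_assoc, ← act, h', smul_zero, smul_zero, add_zero]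
        smul_mem' := by
          rintro r s ⟨m, h⟩
          obtain ⟨t, ht⟩ := H.npow1 m r.unop
          refine ⟨m, ?_⟩
          show op (s * r.unop * x ^ m) • e = 0
          rw [mul_assoc, ht, ← mul_assoc, ← act, h, smul_zero] }
    have hsat : ∀ s, s * x ∈ J → s ∈ J := by
      rintro s ⟨m, h⟩
      exact ⟨m + 1, by rw [pow_succ', ← mul_assoc, h]⟩
    obtain ⟨g, ⟨n, hg⟩, hall, -⟩ := H.saturated_principal J hsat
    have hJ : ∀ s ∈ J, op (s * x ^ n) • e = 0 := by
      intro s hs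
      obtain ⟨b, rfl⟩ := hall s hs
      obtain ⟨t, ht⟩ := H.npow1 n b
      rw [mul_assoc, ht, ← mul_assoc, ← act, hg, smul_zero]
    refine ⟨n + 1, ?_⟩
    by_contra hne
    obtain ⟨s, hs, hs0⟩ := hess _ hne
    rw [act] at hs hs0
    obtain ⟨s', hs'⟩ := H.npow2 (n + 1) s
    rw [hs'] at hs hs0
    have h1 := hUx _ hs
    rw [act, mul_assoc, ← pow_succ] at h1
    have h2 := hJ s' ⟨_, h1⟩
    apply hs0
    rw [pow_succ, ← mul_assoc, ← act, h2, smul_zero]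
  have hB0 : ∀ u ∈ U, ∃ h, π h ≠ 0 ∧ op h • u = 0 := by
    intro u hu
    by_cases h1 : op θ • u = 0
    · exact ⟨θ, by rw [H.piθ]; exact X_ne_zero, h1⟩
    · obtain ⟨s, hs⟩ := hsim _ (U.smul_mem _ hu) h1 u hu
      rw [act] at hs
      refine ⟨1 - θ * s, ?_, ?_⟩
      · intro h0
        have := congrArg (fun p => p.coeff 0) h0
        simp [H.piθ] at this
      · rw [op_sub, sub_smul, hs]; simp
  have hB : ∀ n : ℕ, ∀ e : E, op (x ^ n) • e = 0 → ∃ h, π h ≠ 0 ∧ op h • e = 0 := by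
    intro n
    induction n with
    | zero =>
      intro e he
      exact ⟨1, by simp, by simpa using he⟩
    | succ n ih =>
      intro e he
      obtain ⟨h', hh', hk⟩ := ih (op x • e) (by rw [act, ← pow_succ', he])
      rw [act] at hk
      obtain ⟨h2, hh2⟩ := H.normal2 h'
      have hπ2 : π h2 ≠ 0 := by
        intro h0
        obtain ⟨t, rfl⟩ := (H.ker h2).1 h0
        rw [mul_assoc] at hh2
        have := mul_left_cancel₀ H.xne hh2
        apply hh'
        rw [this, map_mul, H.pix, mul_zero]
      by_cases h1 : op h2 • e = 0
      · exact ⟨h2, hπ2, h1⟩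
      · obtain ⟨s, hs, hs0⟩ := hess _ h1
        have hπs : π s ≠ 0 := by
          intro h0
          obtain ⟨t, rfl⟩ := (H.ker s).1 h0
          apply hs0
          rw [act, ← mul_assoc, ← act, ← hh2, hk, smul_zero]
        obtain ⟨h3, hh3, hk3⟩ := hB0 _ hs
        refine ⟨h2 * s * h3, ?_, ?_⟩
        · rw [map_mul, map_mul]
          exact mul_ne_zero (mul_ne_zero hπ2 hπs) hh3
        · rw [← act, ← act, hk3]
  obtain ⟨n, hn⟩ := hA e
  obtain ⟨h, hh, hk⟩ := hB n e hn
  exact H.artinian_of_killed e n hn h hh hk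

/-- Artinian submodules divisible by `x` and by all irreducibles of type (C). -/
def GoodSub (x : S) (π : S →+* Polynomial k) (N : Submodule Sᵐᵒᵖ E) : Prop :=
  IsArtinian Sᵐᵒᵖ N ∧ ∀ p : S, (p = x ∨ (Irreducible p ∧ π p ≠ 0 ∧ ¬ IsUnit (π p))) →
    ∀ n ∈ N, ∃ n' ∈ N, op p • n' = n

theorem GoodSub.sup {N N' : Submodule Sᵐᵒᵖ E} (h : GoodSub x π N) (h' : GoodSub x π N') :
    GoodSub x π (N ⊔ N') := by
  obtain ⟨h1, h2⟩ := h
  obtain ⟨h1', h2'⟩ := h'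
  refine ⟨inferInstance, fun p hp n hn => ?_⟩
  obtain ⟨a, ha, b, hb, rfl⟩ := Submodule.mem_sup.1 hn
  obtain ⟨a', ha', rfl⟩ := h2 p hp a ha
  obtain ⟨b', hb', rfl⟩ := h2' p hp b hb
  exact ⟨a' + b', Submodule.add_mem_sup ha' hb', by rw [smul_add]⟩

theorem artinian_sup_span (H : SkewFacts x π c θ ℓ deg) (N : Submodule Sᵐᵒᵖ E)
    (hN : IsArtinian Sᵐᵒᵖ N) (p : S) (hp : Irreducible p) (hπ : IsUnit (π p)) (e : E)
    (hep : op p • e ∈ N) : IsArtinian Sᵐᵒᵖ (N ⊔ Submodule.span Sᵐᵒᵖ {e} : Submodule Sᵐᵒᵖ E) := by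
  have hs := H.simple_B p hp hπ
  let g : S →ₗ[Sᵐᵒᵖ] (E ⧸ N) :=
    { toFun := fun t => op t • N.mkQ e
      map_add' := fun a b => by rw [op_add, add_smul]
      map_smul' := fun a b => by
        show op (b * a.unop) • N.mkQ e = a • op b • N.mkQ e
        rw [← act]; rfl }
  let G : rQuot S p →ₗ[Sᵐᵒᵖ] (E ⧸ N) := (rSpan S p).liftQ g (by
    rw [Submodule.span_singleton_le_iff_mem, LinearMap.mem_ker]
    show op p • N.mkQ e = 0
    rw [← map_smul]
    exact (Submodule.Quotient.mk_eq_zero N).2 hep)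
  have hG : IsArtinian Sᵐᵒᵖ (LinearMap.range G) :=
    isArtinian_of_surjective _ G.rangeRestrict G.surjective_rangeRestrict
  let M := N ⊔ Submodule.span Sᵐᵒᵖ {e}
  let q : M →ₗ[Sᵐᵒᵖ] LinearMap.range G := (N.mkQ.comp M.subtype).codRestrict _ (by
    rintro ⟨y, hy⟩
    obtain ⟨n, hn, d, hd, rfl⟩ := Submodule.mem_sup.1 hy
    obtain ⟨a, rfl⟩ := Submodule.mem_span_singleton.1 hd
    refine ⟨Submodule.Quotient.mk a.unop, ?_⟩
    show a • N.mkQ e = N.mkQ (n + a • e)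
    rw [map_add, map_smul]
    have : N.mkQ n = 0 := by simpa using hn
    rw [this, zero_add])
  apply isArtinian_of_range_eq_ker (Submodule.inclusion (le_sup_left : N ≤ M)) q
  rw [Submodule.range_inclusion]
  ext y
  rw [LinearMap.mem_ker, Submodule.mem_comap, ← Subtype.coe_inj]
  show _ ↔ N.mkQ (y : E) = 0
  simp

theorem case_two (H : SkewFacts x π c θ ℓ deg)
    (hext : ∀ w z : S, Irreducible w → IsUnit (π w) → Irreducible z → π z ≠ 0 →
      ¬ IsUnit (π z) → ∀ s : S, ∃ a b, s = w * a + b * z)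
    (U : Submodule Sᵐᵒᵖ E) (hUart : IsArtinian Sᵐᵒᵖ U)
    (hess : ∀ e : E, e ≠ 0 → ∃ s : S, op s • e ∈ U ∧ op s • e ≠ 0)
    (hsim : ∀ u ∈ U, u ≠ 0 → ∀ u' ∈ U, ∃ s : S, op s • u = u')
    (hUx : ∃ u ∈ U, op x • u ≠ 0) (e : E) :
    IsArtinian Sᵐᵒᵖ (Submodule.span Sᵐᵒᵖ {e}) := by
  have := H.nzd
  have := H.nontriv
  have htfU : ∀ u ∈ U, op x • u = 0 → u = 0 := by
    intro u hu h0
    by_contra hne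
    obtain ⟨u1, hu1, hu1x⟩ := hUx
    obtain ⟨s, rfl⟩ := hsim u hu hne u1 hu1
    obtain ⟨t, ht⟩ := H.normal1 s
    rw [act, ht, ← act, h0, smul_zero] at hu1x
    exact hu1x rfl
  have htf : ∀ e : E, op x • e = 0 → e = 0 := by
    intro e h0
    by_contra hne
    obtain ⟨s, hs, hs0⟩ := hess e hne
    apply hs0
    apply htfU _ hs
    obtain ⟨t, ht⟩ := H.normal1 s
    rw [act, ht, ← act, h0, smul_zero]
  have htfn : ∀ n : ℕ, ∀ e : E, op (x ^ n) • e = 0 → e = 0 := by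
    intro n
    induction n with
    | zero => intro e he; simpa using he
    | succ n ih =>
      intro e he
      rw [pow_succ, ← act] at he
      exact ih e (htf _ he)
  have hUdx : ∀ u ∈ U, ∃ s : S, op (s * x) • u = u := by
    intro u hu
    by_cases h0 : u = 0
    · exact ⟨0, by simp [h0]⟩
    · obtain ⟨s, hs⟩ := hsim (op x • u) (U.smul_mem _ hu) (fun h => h0 (htfU u hu h)) u hu
      obtain ⟨t, ht⟩ := H.normal2 s
      rw [act, ht] at hs
      exact ⟨t, hs⟩
  have hUdxn : ∀ n : ℕ, ∀ u ∈ U, ∃ u' ∈ U, op (x ^ n) • u' = u := by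
    intro n
    induction n with
    | zero => intro u hu; exact ⟨u, hu, by simp⟩
    | succ n ih =>
      intro u hu
      obtain ⟨s, hs⟩ := hUdx u hu
      obtain ⟨u', hu', h'⟩ := ih (op s • u) (U.smul_mem _ hu)
      exact ⟨u', hu', by rw [pow_succ, ← act, h', act, hs]⟩
  have hfac : ∀ n : ℕ, ∀ g : S, ℓ g = n → g ≠ 0 → IsUnit (π g) → ∀ u ∈ U, u ≠ 0 → op g • u = 0 →
      ∃ w, Irreducible w ∧ IsUnit (π w) ∧ ∃ u' ∈ U, u' ≠ 0 ∧ op w • u' = 0 := by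
    intro n
    induction n using Nat.strong_induction_on with
    | _ n ih =>
      intro g hgn hg0 hπ u hu hu0 hgu
      have hgnu : ¬ IsUnit g := by
        intro hun
        apply hu0
        have : op (g * (hun.unit⁻¹ : Sˣ).1) • u = 0 := by rw [← act, hgu, smul_zero]
        rw [IsUnit.mul_val_inv] at this
        simpa using this
      obtain ⟨p, t, hp, hgt, hlt, ht0⟩ := H.exists_factor _ g rfl hg0 hgnu
      rw [hgt, map_mul] at hπ
      by_cases hpu : op p • u = 0
      · exact ⟨p, hp, isUnit_of_mul_isUnit_left hπ, u, hu, hu0, hpu⟩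
      · exact ih (ℓ t) (by omega) t rfl ht0 (isUnit_of_mul_isUnit_right hπ) _ (U.smul_mem _ hu) hpu
          (by rw [act, ← hgt, hgu])
  obtain ⟨w, hw, hπw, u0, hu0, hu00, hwu⟩ : ∃ w, Irreducible w ∧ IsUnit (π w) ∧
      ∃ u' ∈ U, u' ≠ 0 ∧ op w • u' = 0 := by
    obtain ⟨u, hu, hux⟩ := hUx
    have hune : u ≠ 0 := by rintro rfl; simp at hux
    obtain ⟨s, hs⟩ := hUdx u hu
    have hπ1 : π (1 - s * x) = 1 := by rw [map_sub, map_mul, H.pix]; simp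
    refine hfac _ (1 - s * x) rfl ?_ (by rw [hπ1]; exact isUnit_one) u hu hune ?_
    · intro h0
      rw [h0, map_zero] at hπ1
      exact zero_ne_one hπ1
    · rw [op_sub, sub_smul, hs]; simp
  have hUgood : GoodSub x π U := by
    refine ⟨hUart, ?_⟩
    rintro p (rfl | ⟨hp, hp0, hpu⟩) u hu
    · simpa using hUdxn 1 u hu
    · obtain ⟨s, rfl⟩ := hsim u0 hu0 hu00 u hu
      obtain ⟨a, b, rfl⟩ := hext w p hw hπw hp hp0 hpu s
      refine ⟨op b • u0, U.smul_mem _ hu0, ?_⟩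
      rw [act, op_add, add_smul, ← act u0 w a, hwu, smul_zero, zero_add]
  have main : ∀ n : ℕ, ∀ (g : S) (e : E), ℓ g = n → g ≠ 0 → op g • e = 0 →
      ∃ N, GoodSub x π N ∧ e ∈ N := by
    intro n
    induction n using Nat.strong_induction_on with
    | _ n ih =>
      intro g e hgn hg0 hge
      by_cases hgu : IsUnit g
      · refine ⟨U, hUgood, ?_⟩
        have : op (g * (hgu.unit⁻¹ : Sˣ).1) • e = 0 := by rw [← act, hge, smul_zero]
        rw [IsUnit.mul_val_inv] at this
        have h1 : e = 0 := by simpa using this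
        rw [h1]; exact U.zero_mem
      obtain ⟨p, t, hp, hgt, hlt, ht0⟩ := H.exists_factor _ g rfl hg0 hgu
      obtain ⟨N, hN, hepN⟩ := ih (ℓ t) (by omega) t (op p • e) rfl ht0 (by rw [act, ← hgt, hge])
      by_cases hπ0 : π p = 0
      · obtain ⟨y, hy⟩ := (H.ker p).1 hπ0
        have hyu := (hp.isUnit_or_isUnit hy).resolve_left H.x_nonunit
        have hex : op x • e ∈ N := by
          have h1 := N.smul_mem (op (hyu.unit⁻¹ : Sˣ).1) hepN
          rw [act, hy, mul_assoc, IsUnit.mul_val_inv, mul_one] at h1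
          exact h1
        obtain ⟨n', hn', hnx⟩ := hN.2 x (Or.inl rfl) _ hex
        refine ⟨N, hN, ?_⟩
        have : op x • (e - n') = 0 := by rw [smul_sub, hnx, sub_self]
        rw [sub_eq_zero.1 (htf _ this)]
        exact hn'
      by_cases hπu : IsUnit (π p)
      · refine ⟨N ⊔ Submodule.span Sᵐᵒᵖ {e},
          ⟨H.artinian_sup_span N hN.1 p hp hπu e hepN, ?_⟩,
          Submodule.mem_sup_right (Submodule.mem_span_singleton_self e)⟩
        intro q hq y hy
        obtain ⟨n1, hn1, d, hd, rfl⟩ := Submodule.mem_sup.1 hy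
        obtain ⟨s, rfl⟩ := Submodule.mem_span_singleton.1 hd
        obtain ⟨a, b, hab⟩ : ∃ a b, s.unop = p * a + b * q := by
          rcases hq with rfl | ⟨hq, hq0, hqu⟩
          · simpa using H.B_div p hπu 1 s.unop
          · exact hext p q hp hπu hq hq0 hqu _
        have hs : s = op (p * a + b * q) := by rw [← hab, op_unop]
        obtain ⟨n2, hn2, hn2q⟩ := hN.2 q hq (n1 + op a • op p • e)
          (N.add_mem hn1 (N.smul_mem _ hepN))
        refine ⟨n2 + op b • e, Submodule.add_mem_sup hn2
          (Submodule.smul_mem _ _ (Submodule.mem_span_singleton_self e)), ?_⟩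
        rw [smul_add, hn2q, hs, op_add, add_smul, act, act, add_assoc]
      · obtain ⟨n1, hn1, hn1p⟩ := hN.2 p (Or.inr ⟨hp, hπ0, hπu⟩) _ hepN
        have he' : op p • (e - n1) = 0 := by rw [smul_sub, hn1p, sub_self]
        have heU : e - n1 ∈ U := by
          by_cases h0 : e - n1 = 0
          · rw [h0]; exact U.zero_mem
          obtain ⟨s, hs, hs0⟩ := hess _ h0
          have hsp : ¬ ∃ b, s = p * b := by
            rintro ⟨b, rfl⟩
            apply hs0
            rw [← act, he', smul_zero]
          obtain ⟨m, a, b, hab⟩ := H.xpow_mem p s hp hπ0 hsp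
          have h1 : op (x ^ m) • (e - n1) ∈ U := by
            rw [hab, op_add, add_smul, ← act, he', smul_zero, zero_add, ← act]
            exact U.smul_mem _ hs
          obtain ⟨u', hu', h2⟩ := hUdxn m _ h1
          have h3 : op (x ^ m) • (e - n1 - u') = 0 := by rw [smul_sub, h2, sub_self]
          rw [sub_eq_zero.1 (htfn m _ h3)]
          exact hu'
        refine ⟨N ⊔ U, hN.sup hUgood, ?_⟩
        have : e = n1 + (e - n1) := by abel
        rw [this]
        exact Submodule.add_mem_sup hn1 heU
  obtain ⟨g, hg0, hge⟩ : ∃ g : S, g ≠ 0 ∧ op g • e = 0 := by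
    by_cases h0 : e = 0
    · exact ⟨1, one_ne_zero, by simp [h0]⟩
    obtain ⟨s, hs, hs0⟩ := hess e h0
    have hsne : s ≠ 0 := by rintro rfl; simp at hs0
    obtain ⟨t, ht⟩ := hUdx _ hs
    refine ⟨s * (1 - t * x), mul_ne_zero hsne ?_, ?_⟩
    · intro h1
      have hπ1 : π (1 - t * x) = 1 := by rw [map_sub, map_mul, H.pix]; simp
      rw [h1, map_zero] at hπ1
      exact zero_ne_one hπ1
    · rw [← act, op_sub, sub_smul, ht]; simp
  obtain ⟨N, hN, heN⟩ := main _ g e rfl hg0 hge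
  have := hN.1
  exact isArtinian_of_le (show Submodule.span Sᵐᵒᵖ {e} ≤ N by
    rwa [Submodule.span_singleton_le_iff_mem])

theorem diamond_of (H : SkewFacts x π c θ ℓ deg)
    (hext : ∀ w z : S, Irreducible w → IsUnit (π w) → Irreducible z → π z ≠ 0 →
      ¬ IsUnit (π z) → ∀ s : S, ∃ a b, s = w * a + b * z) : HasDiamond Sᵐᵒᵖ := by
  intro V E _ _ _ _ f hV hf N hN
  obtain ⟨-, hfi, hess0⟩ := hf
  let U := LinearMap.range f
  have hUart : IsArtinian Sᵐᵒᵖ U :=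
    isArtinian_of_surjective _ f.rangeRestrict f.surjective_rangeRestrict
  have hess : ∀ e : E, e ≠ 0 → ∃ s : S, op s • e ∈ U ∧ op s • e ≠ 0 := by
    intro e he
    obtain ⟨y, ⟨hy1, hy2⟩, hy0⟩ := Submodule.exists_mem_ne_zero_of_ne_bot
      (hess0 (Submodule.span Sᵐᵒᵖ {e}) (by simpa using he))
    obtain ⟨a, rfl⟩ := Submodule.mem_span_singleton.1 hy1
    exact ⟨a.unop, hy2, hy0⟩
  have hsim : ∀ u ∈ U, u ≠ 0 → ∀ u' ∈ U, ∃ s : S, op s • u = u' := by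
    rintro _ ⟨v, rfl⟩ hu _ ⟨v', rfl⟩
    have hv : v ≠ 0 := by rintro rfl; simp at hu
    obtain ⟨a, ha⟩ := IsSimpleModule.toSpanSingleton_surjective Sᵐᵒᵖ hv v'
    refine ⟨a.unop, ?_⟩
    rw [← ha]
    simp
  have hall : ∀ e : E, IsArtinian Sᵐᵒᵖ (Submodule.span Sᵐᵒᵖ {e}) := by
    intro e
    by_cases hUx : ∀ u ∈ U, op x • u = 0
    · exact H.case_one U hess hsim hUx e
    · push Not at hUx
      exact H.case_two hext U hUart hess hsim hUx e
  induction N, hN using Submodule.fg_induction with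
  | singleton e => exact hall e
  | sup N1 N2 _ _ h1 h2 => infer_instance

end SkewFacts

namespace SkewFacts

variable {k S T : Type u} [Field k] [Ring S] [Ring T] {x : S} {π : S →+* Polynomial k}
  {c : k →+* S} {θ : S} {ℓ deg : S → ℕ} {ψ : S →+* T}

theorem loc_decomp (H : SkewFacts x π c θ ℓ deg) (hT : IsLocalizationAt x ψ) (w : S)
    (hw : IsUnit (π w)) (t : T) : ∃ (a : T) (b : S), t = ψ w * a + ψ b := by
  obtain ⟨s, n, hs⟩ := hT.surj t
  obtain ⟨a, b, hab⟩ := H.B_div w hw n s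
  obtain ⟨v, hv⟩ := hT.unit.pow n
  refine ⟨ψ a * (v⁻¹ : Tˣ), b, ?_⟩
  rw [← hv] at hs
  have h1 : t = ψ s * (v⁻¹ : Tˣ) := by rw [← hs, mul_assoc, Units.mul_inv, mul_one]
  rw [h1, hab, map_add, map_mul, map_mul, map_pow, ← hv, add_mul, mul_assoc, mul_assoc (ψ b),
    Units.mul_inv, mul_one]

theorem loc_iff (H : SkewFacts x π c θ ℓ deg) (hT : IsLocalizationAt x ψ) (w z : S)
    (hw : IsUnit (π w)) : (∀ s : S, ∃ a b, s = w * a + b * z) ↔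
      ∀ t : T, ∃ a b, t = ψ w * a + b * ψ z := by
  constructor
  · intro h t
    obtain ⟨a, b, hab⟩ := H.loc_decomp hT w hw t
    obtain ⟨a', b', h'⟩ := h b
    refine ⟨a + ψ a', ψ b', ?_⟩
    rw [hab, h', map_add, map_mul, map_mul, mul_add, add_assoc]
  · intro h s
    obtain ⟨a, b, hab⟩ := h (ψ s)
    obtain ⟨e, b', hb⟩ := H.loc_decomp hT w hw b
    obtain ⟨d', n, hd⟩ := hT.surj (a + e * ψ z)
    have h1 : ψ ((s - b' * z) * x ^ n) = ψ (w * d') := by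
      rw [map_mul, map_mul, map_pow, ← hd, map_sub, map_mul, hab, hb, ← mul_assoc]
      congr 1
      noncomm_ring
    obtain ⟨y, hy⟩ := H.cancel_pow w hw.ne_zero n _ _ (hT.inj h1)
    exact ⟨y, b', by rw [← hy]; simp⟩

theorem loc_reg1 (H : SkewFacts x π c θ ℓ deg) (hT : IsLocalizationAt x ψ) (z : S) (hz : z ≠ 0)
    (t : T) (ht : ψ z * t = 0) : t = 0 := by
  have := H.nzd
  obtain ⟨s, n, hs⟩ := hT.surj t
  have h1 : ψ (z * s) = ψ 0 := by rw [map_mul, ← hs, ← mul_assoc, ht, zero_mul, map_zero]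
  have h2 : s = 0 := (mul_eq_zero.1 (hT.inj h1)).resolve_left hz
  rw [h2, map_zero] at hs
  exact ((hT.unit.pow n).mul_left_eq_zero).1 hs

theorem loc_reg2 (H : SkewFacts x π c θ ℓ deg) (hT : IsLocalizationAt x ψ) (w : S) (hw : w ≠ 0)
    (t : T) (ht : t * ψ w = 0) : t = 0 := by
  have := H.nzd
  have := H.nontriv
  obtain ⟨s, n, hs⟩ := hT.surj t
  obtain ⟨w', hw'⟩ := H.npow1 n w
  have h1 : ψ (s * w') = ψ 0 := by
    rw [map_mul, ← hs, ← map_pow, mul_assoc, ← map_mul, ← hw', map_mul, ← mul_assoc, ht, zero_mul,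
      map_zero]
  have h3 : w' ≠ 0 := by
    rintro rfl
    rw [mul_zero] at hw'
    rcases mul_eq_zero.1 hw' with h | h
    · exact hw h
    · exact pow_ne_zero n H.xne h
  have h2 : s = 0 := (mul_eq_zero.1 (hT.inj h1)).resolve_right h3
  rw [h2, map_zero] at hs
  exact ((hT.unit.pow n).mul_left_eq_zero).1 hs

end SkewFacts

namespace TypeAux

variable {k R S : Type u} [Field k] [CommRing R] [Algebra k R] [Ring S]
  {X : R} {φ : R →+* S} {π : S →+* Polynomial k} {θ : S} {ℓ deg : S → ℕ}

theorem pi_thetaPoly (H : SkewFacts (φ X) π (φ.comp (algebraMap k R)) θ ℓ deg)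
    (p : Polynomial k) : π (thetaPoly φ θ p) = p := by
  unfold thetaPoly
  rw [Polynomial.sum_def, map_sum]
  conv_rhs => rw [p.as_sum_support_C_mul_X_pow]
  refine Finset.sum_congr rfl fun n _ => ?_
  have := H.pic (p.coeff n)
  rw [RingHom.comp_apply] at this
  rw [map_mul, map_pow, H.piθ, this]

theorem B_unit (H : SkewFacts (φ X) π (φ.comp (algebraMap k R)) θ ℓ deg) {w : S}
    (hw : IsTypeB X φ w) : IsUnit (π w) := by
  obtain ⟨u, s, -, h⟩ := hw
  have := congrArg π h
  rw [map_mul, map_add, map_mul, H.pix, map_one, zero_mul, add_zero] at this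
  exact IsUnit.of_mul_eq_one_right _ this

theorem C_nonunit (H : SkewFacts (φ X) π (φ.comp (algebraMap k R)) θ ℓ deg) {z : S}
    (hz : IsTypeC k X φ θ z) : π z ≠ 0 ∧ ¬ IsUnit (π z) := by
  obtain ⟨u, p, s, hp, hd, h, -⟩ := hz
  have := congrArg π h
  rw [map_mul, map_add, map_mul, H.pix, zero_mul, add_zero, pi_thetaPoly H] at this
  constructor
  · intro h0
    rw [h0, mul_zero] at this
    exact hp.ne_zero this.symm
  · intro hu
    have h2 : IsUnit p := by rw [← this]; exact (u.isUnit.map π).mul hu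
    have := Polynomial.natDegree_eq_zero_of_isUnit h2
    omega

theorem unit_B (H : SkewFacts (φ X) π (φ.comp (algebraMap k R)) θ ℓ deg)
    (hX : ∀ r, IsUnit (1 + X * r)) {w : S} (hw : Irreducible w) (hu : IsUnit (π w)) :
    IsTypeB X φ w := by
  obtain ⟨r, hr, hr'⟩ := Polynomial.isUnit_iff.1 hu
  have hr0 : r ≠ 0 := hr.ne_zero
  let v : kˣ := (Units.mk0 r hr0)⁻¹
  let U : Sˣ := Units.map ((φ.comp (algebraMap k R)) : k →* S) v
  have hU : (U : S) = (φ.comp (algebraMap k R)) r⁻¹ := by simp [U, v]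
  have h1 : π (U * w - 1) = 0 := by
    rw [map_sub, map_mul, hU, H.pic, ← hr', map_one, ← Polynomial.C_mul, inv_mul_cancel₀ hr0]
    simp
  obtain ⟨s, hs⟩ := (H.ker _).1 h1
  have hs' : (U : S) * w = 1 + φ X * s := by rw [← hs]; simp
  refine ⟨U, s, ?_, hs'⟩
  rintro ⟨r, rfl⟩
  have h2 : IsUnit ((U : S) * w) := by
    rw [hs', ← map_mul, ← map_one φ, ← map_add]
    exact (hX r).map φ
  exact hw.not_isUnit ((Units.isUnit_units_mul U w).1 h2)

theorem nonunit_C (H : SkewFacts (φ X) π (φ.comp (algebraMap k R)) θ ℓ deg)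
    (hX : IsUnit (1 + X)) {z : S} (hz0 : π z ≠ 0) (hu : ¬ IsUnit (π z)) :
    IsTypeC k X φ θ z := by
  have := H.nzd
  have := H.nontriv
  have hr0 : (π z).leadingCoeff ≠ 0 := by simpa using hz0
  set r := (π z).leadingCoeff with hr
  let v : kˣ := (Units.mk0 r hr0)⁻¹
  let U : Sˣ := Units.map ((φ.comp (algebraMap k R)) : k →* S) v
  have hU : (U : S) = (φ.comp (algebraMap k R)) r⁻¹ := by simp [U, v]
  let f : Polynomial k := Polynomial.C r⁻¹ * π z
  have hf : f.Monic := by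
    rw [Polynomial.Monic, Polynomial.leadingCoeff_mul, Polynomial.leadingCoeff_C, ← hr,
      inv_mul_cancel₀ hr0]
  have hfd : 1 ≤ f.natDegree := by
    rw [Nat.one_le_iff_ne_zero]
    intro h0
    apply hu
    have h1 : f.natDegree = (π z).natDegree := Polynomial.natDegree_C_mul (inv_ne_zero hr0)
    rw [h1] at h0
    rw [Polynomial.eq_C_of_natDegree_eq_zero h0] at hz0 ⊢
    rw [Polynomial.isUnit_C]
    exact isUnit_iff_ne_zero.2 (by simpa using hz0)
  have hπU : π (U * z) = f := by rw [map_mul, hU, H.pic]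
  have h1 : π (U * z - thetaPoly φ θ f) = 0 := by
    rw [map_sub, hπU, pi_thetaPoly H, sub_self]
  obtain ⟨s, hs⟩ := (H.ker _).1 h1
  have hs' : (U : S) * z = thetaPoly φ θ f + φ X * s := by rw [← hs]; simp
  by_cases hθ : (U : S) * z = θ
  · obtain ⟨y, hy⟩ := hX
    refine ⟨Units.map (φ : R →* S) y * U, f, s + θ, hf, hfd, ?_, ?_⟩
    · rw [Units.val_mul, mul_assoc, mul_add, ← add_assoc, ← hs', hθ]
      simp [hy, add_mul]
    · rw [Units.val_mul, mul_assoc, hθ]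
      simp only [Units.coe_map, MonoidHom.coe_coe, hy, map_add, map_one, add_mul, one_mul]
      intro h
      have h2 : φ X * θ = 0 := by simpa using h
      rcases mul_eq_zero.1 h2 with h3 | h3
      · exact H.xne h3
      · have := H.piθ
        rw [h3, map_zero] at this
        exact Polynomial.X_ne_zero this.symm
  · exact ⟨U, f, s, hf, hfd, hs', hθ⟩

end TypeAux

/-- (1) For irreducible `w, z ∈ S` with `w` of type (B) and `z` of
type (C), the following are equivalent: (a) `Ext¹_S(S/zS, S/wS) = 0` (right modules);
(b) `Ext¹_S(S/Sw, S/Sz) = 0` (left modules); (c) `Ext¹_T(T/zT, T/wT) = 0`;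
(d) `Ext¹_T(T/Tw, T/Tz) = 0`.  (2) `S` satisfies right `(◊)` iff these hold for all
such pairs `z`, `w`. -/
theorem ext_criterion_for_diamond
    {k : Type u} [Field k]
    {R : Type u} [CommRing R] [IsDomain R] [IsDiscreteValuationRing R] [Algebra k R]
    (X : R) (hX : IsLocalRing.maximalIdeal R = Ideal.span {X})
    (hres : Function.Bijective ((IsLocalRing.residue R).comp (algebraMap k R)))
    (α : R ≃ₐ[k] R) (hord : ∀ n : ℕ, 0 < n → α ^ n ≠ 1)
    {S : Type u} [Ring S] (φ : R →+* S) (θ : S)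
    (hS : IsSkewPolynomialRing α.toRingEquiv φ θ)
    {T : Type u} [Ring T] (ψ : S →+* T) (hT : IsLocalizationAt (φ X) ψ) :
    (∀ w z : S, Irreducible w → IsTypeB X φ w → Irreducible z → IsTypeC k X φ θ z →
      ((ExtVanish Sᵐᵒᵖ (rQuot S z) (rQuot S w) ↔ ExtVanish S (lQuot S w) (lQuot S z)) ∧
       (ExtVanish Sᵐᵒᵖ (rQuot S z) (rQuot S w) ↔
         ExtVanish Tᵐᵒᵖ (rQuot T (ψ z)) (rQuot T (ψ w))) ∧
       (ExtVanish Sᵐᵒᵖ (rQuot S z) (rQuot S w) ↔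
         ExtVanish T (lQuot T (ψ w)) (lQuot T (ψ z))))) ∧
    (HasDiamond Sᵐᵒᵖ ↔
      ∀ w z : S, Irreducible w → IsTypeB X φ w → Irreducible z → IsTypeC k X φ θ z →
        ExtVanish Sᵐᵒᵖ (rQuot S z) (rQuot S w)) := by
  classical
  have hXi : Irreducible X := (IsDiscreteValuationRing.irreducible_iff_uniformizer X).2 hX
  let e : k ≃+* IsLocalRing.ResidueField R := RingEquiv.ofBijective _ hres
  let ρ : R →+* k := (e.symm : IsLocalRing.ResidueField R →+* k).comp (IsLocalRing.residue R)
  have hρι : ∀ a, ρ (algebraMap k R a) = a := fun a => e.symm_apply_apply a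
  have hρX : ∀ r, ρ r = 0 ↔ X ∣ r := by
    intro r
    rw [← Ideal.mem_span_singleton, ← hX, ← IsLocalRing.residue_eq_zero_iff]
    exact map_eq_zero_iff e.symm e.symm.injective
  have hρ : ∀ r, ρ (α.toRingEquiv r) = ρ r := by
    intro r
    have h1 : X ∣ r - algebraMap k R (ρ r) := by rw [← hρX, map_sub, hρι, sub_self]
    have h2 : X ∣ α.toRingEquiv (r - algebraMap k R (ρ r)) :=
      h1.trans (SkewAux.assoc_aut hXi α.toRingEquiv _).symm.dvd
    rw [← hρX, map_sub, map_sub] at h2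
    have h3 : α.toRingEquiv (algebraMap k R (ρ r)) = algebraMap k R (ρ r) := α.commutes _
    rw [h3, hρι] at h2
    exact sub_eq_zero.1 h2
  have H := SkewAux.facts hS hXi ρ hρ hρX (algebraMap k R) (fun a => α.commutes a) hρι
  have := H.nzd
  have := H.nontriv
  have hXu : ∀ r, IsUnit (1 + X * r) := by
    intro r
    have h1 : X * r ∈ IsLocalRing.maximalIdeal R := by
      rw [hX, Ideal.mem_span_singleton]; exact dvd_mul_right _ _
    by_contra h2
    have h3 := (IsLocalRing.mem_maximalIdeal _).2 h2
    have h4 := Ideal.sub_mem _ h3 h1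
    rw [add_sub_cancel_right] at h4
    exact (IsLocalRing.mem_maximalIdeal _).1 h4 isUnit_one
  have eR : ∀ w z : S, z ≠ 0 → (ExtVanish Sᵐᵒᵖ (rQuot S z) (rQuot S w) ↔
      ∀ s, ∃ a b, s = w * a + b * z) := fun w z hz =>
    ExtAux.ext_right w z fun a ha => (mul_eq_zero.1 ha).resolve_left hz
  refine ⟨?_, ?_, ?_⟩
  · intro w z hw hwB hz hzC
    have hu := TypeAux.B_unit H hwB
    rw [eR w z hz.ne_zero,
      ExtAux.ext_left w z fun a ha => (mul_eq_zero.1 ha).resolve_right hw.ne_zero,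
      ExtAux.ext_right (ψ w) (ψ z) (H.loc_reg1 hT z hz.ne_zero),
      ExtAux.ext_left (ψ w) (ψ z) (H.loc_reg2 hT w hw.ne_zero)]
    exact ⟨Iff.rfl, H.loc_iff hT w z hu, H.loc_iff hT w z hu⟩
  · intro hd w z hw hwB hz hzC
    rw [eR w z hz.ne_zero]
    exact H.diamond_imp hd w z hw (TypeAux.B_unit H hwB) hz (TypeAux.C_nonunit H hzC).1
      (TypeAux.C_nonunit H hzC).2
  · intro hext
    apply H.diamond_of
    intro w z hw hwu hz hz0 hzu
    rw [← eR w z hz.ne_zero]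
    exact hext w z hw (TypeAux.unit_B H hXu hw hwu) hz
      (TypeAux.nonunit_C H (by simpa using hXu 1) hz0 hzu)
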